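/- arXiv:1710.00799 — 2 statements merged into one kernel-verified Lean document; each statement's English description precedes it below -/
import Mathlib

section
/- Let ε > 0 be a constant. Consider the random graph process {G_i} on an even number n of vertices, and let m_1 = min{m : δ(G_m) ≥ 1} be the step at which the last isolated vertex disappears. Then asymptotically almost surely G_{m_1} is (1/2 − ε)-resilient with respect to containing a perfect matching. -/
open MeasureTheory Filter ENNReal

namespace RGP

noncomputable section

variable {V : Type*}

/-- The degree of a vertex. -/
def deg (G : SimpleGraph V) (v : V) : ℕ := (G.neighborSet v).ncard

/-- `N^ℓ_G(v)`: vertices at distance at most `ℓ` from `v`, excluding `v`. -/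
def nbhd (G : SimpleGraph V) (ℓ : ℕ) (v : V) : Set V :=
  {u | u ≠ v ∧ ∃ p : G.Walk v u, p.length ≤ ℓ}

/-- `TINY_{p,δ}(G)`. -/
def TINY (G : SimpleGraph V) (p δ : ℝ) : Set V :=
  {v | (deg G v : ℝ) < δ * (Nat.card V) * p}

/-- `ATYP_{p,δ}(G)`. -/
def ATYP (G : SimpleGraph V) (p δ : ℝ) : Set V :=
  {v | (deg G v : ℝ) < (1 - δ) * (Nat.card V) * p ∨ (1 + δ) * (Nat.card V) * p < (deg G v : ℝ)}

/-- Edge density `|E| / C(n,2)`. -/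
def density (G : SimpleGraph V) : ℝ :=
  (G.edgeSet.ncard : ℝ) / ((Nat.card V).choose 2 : ℕ)

/-- A matching covering all but at most one vertex. -/
def HasNearPerfectMatching (G : SimpleGraph V) : Prop :=
  ∃ M : G.Subgraph, M.IsMatching ∧ (M.vertsᶜ).ncard ≤ 1

/-- Hamiltonicity (for finite vertex types). -/
def IsHam [Finite V] (G : SimpleGraph V) : Prop :=
  letI := Classical.decEq V; letI := Fintype.ofFinite V; G.IsHamiltonian

/-- `α`-resilience with respect to a property `P`. -/
def Resilient (G : SimpleGraph V) (α : ℝ) (P : SimpleGraph V → Prop) : Prop :=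
  ∀ H : SimpleGraph V, H ≤ G → (∀ v, (deg H v : ℝ) ≤ α * (deg G v : ℝ)) → P (G \ H)

/-- `(α, δt, Kt, δa, Ka)`-resilience with respect to a property `P`. -/
def StrongResilient (G : SimpleGraph V) (α δt : ℝ) (Kt : ℕ) (δa : ℝ) (Ka : ℕ)
    (P : SimpleGraph V → Prop) : Prop :=
  ∀ H : SimpleGraph V, H ≤ G →
    (∀ v ∈ TINY G (density G) δt, (deg H v : ℝ) ≤ (deg G v : ℝ) - Kt) →
    (∀ v, v ∈ ATYP G (density G) δa → v ∉ TINY G (density G) δt →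
      (deg H v : ℝ) ≤ (deg G v : ℝ) - Ka) →
    (∀ v, v ∉ TINY G (density G) δt → v ∉ ATYP G (density G) δa →
      (deg H v : ℝ) ≤ α * (deg G v : ℝ)) →
    P (G \ H)

/-! ### The random graph process -/

/-- Potential edges of the complete graph on `Fin n`. -/
abbrev EdgeType (n : ℕ) := {e : Sym2 (Fin n) // ¬ e.IsDiag}

/-- A sample point of the random graph process: a uniformly random ordering of the edges. -/
abbrev ProcessSpace (n : ℕ) := Fin (Fintype.card (EdgeType n)) ≃ EdgeType n

instance (n : ℕ) : MeasurableSpace (ProcessSpace n) := ⊤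

/-- The uniform measure on orderings of the edges of `K_n`. -/
def processMeasure (n : ℕ) : Measure (ProcessSpace n) :=
  (Fintype.card (ProcessSpace n) : ℝ≥0∞)⁻¹ • Measure.sum (fun σ => Measure.dirac σ)

/-- The graph `G_m` of the process: the first `m` edges in the random ordering. -/
def processGraph {n : ℕ} (σ : ProcessSpace n) (m : ℕ) : SimpleGraph (Fin n) :=
  SimpleGraph.fromEdgeSet {e | ∃ i : Fin (Fintype.card (EdgeType n)), (i : ℕ) < m ∧ (σ i : Sym2 (Fin n)) = e}

/-! ### The binomial random graph G(n,p) -/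

abbrev GnpSpace (n : ℕ) := EdgeType n → Bool

/-- The Bernoulli product weight of an outcome. -/
def gnpWeight {n : ℕ} (p : ℝ) (ω : GnpSpace n) : ℝ≥0∞ :=
  ∏ e : EdgeType n, (if ω e then ENNReal.ofReal p else ENNReal.ofReal (1 - p))

/-- The `G(n,p)` probability measure. -/
def gnp (n : ℕ) (p : ℝ) : Measure (GnpSpace n) :=
  Measure.sum (fun ω => gnpWeight p ω • Measure.dirac ω)

/-- The graph determined by an outcome of `G(n,p)`. -/
def gnpGraph {n : ℕ} (ω : GnpSpace n) : SimpleGraph (Fin n) :=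
  SimpleGraph.fromEdgeSet {e | ∃ h : ¬ e.IsDiag, ω ⟨e, h⟩ = true}

/-- Joint distribution of two independent binomial random graphs. -/
def gnp2 (n : ℕ) (p₀ p' : ℝ) : Measure (GnpSpace n × GnpSpace n) :=
  Measure.sum (fun ω : GnpSpace n × GnpSpace n =>
    (gnpWeight p₀ ω.1 * gnpWeight p' ω.2) • Measure.dirac ω)

/-! ### The 2-core -/

/-- The vertex set of the 2-core: the largest set every vertex of which has
at least two neighbours inside the set. -/
def coreSet (G : SimpleGraph V) : Set V :=
  ⋃₀ {S : Set V | ∀ v ∈ S, 2 ≤ ((G.neighborSet v) ∩ S).ncard}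

/-- The 2-core of a graph, as a graph on the corresponding vertex subset. -/
def twoCore (G : SimpleGraph V) : SimpleGraph (coreSet G) := G.induce (coreSet G)

section FiniteProbability

variable {Ω : Type*} [Fintype Ω]

/-- The average of `f` over the finite sample space `Ω`. -/
def Ex (f : Ω → ℝ) : ℝ := (∑ ω, f ω) / Fintype.card Ω

open Classical in
/-- The probability of `P` under the uniform distribution on `Ω`. -/
def Pr (P : Ω → Prop) : ℝ := Ex fun ω => if P ω then 1 else 0

lemma Pr_eq_Ex (P : Ω → Prop) [DecidablePred P] :
    Pr P = Ex fun ω => if P ω then 1 else 0 := by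
  refine congrArg Ex (funext fun ω => ?_)
  by_cases h : P ω <;> simp [h]

lemma Ex_mono {f g : Ω → ℝ} (h : ∀ ω, f ω ≤ g ω) : Ex f ≤ Ex g := by
  unfold Ex
  gcongr
  exact h _

lemma Ex_const_mul (c : ℝ) (f : Ω → ℝ) : Ex (fun ω => c * f ω) = c * Ex f := by
  unfold Ex
  rw [← Finset.mul_sum, mul_div_assoc]

lemma Ex_add (f g : Ω → ℝ) : Ex (fun ω => f ω + g ω) = Ex f + Ex g := by
  unfold Ex
  rw [Finset.sum_add_distrib, add_div]

lemma Ex_sum {ι : Type*} (s : Finset ι) (f : ι → Ω → ℝ) :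
    Ex (fun ω => ∑ i ∈ s, f i ω) = ∑ i ∈ s, Ex (f i) := by
  unfold Ex
  rw [Finset.sum_comm, Finset.sum_div]

lemma Ex_one [Nonempty Ω] : Ex (fun _ : Ω => (1 : ℝ)) = 1 := by
  simp [Ex]

lemma Ex_comp_equiv (f : Ω → ℝ) (φ : Ω ≃ Ω) : Ex (fun ω => f (φ ω)) = Ex f := by
  unfold Ex
  rw [Equiv.sum_comp φ f]

lemma Pr_mono {P Q : Ω → Prop} (h : ∀ ω, P ω → Q ω) : Pr P ≤ Pr Q := by
  classical
  refine Ex_mono fun ω => ?_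
  by_cases hP : P ω
  · simp [hP, h ω hP]
  · simp only [hP, if_false]; positivity

lemma Pr_nonneg (P : Ω → Prop) : 0 ≤ Pr P := by
  unfold Pr Ex
  positivity

lemma Pr_le_Ex {P : Ω → Prop} {f : Ω → ℝ} (h0 : ∀ ω, 0 ≤ f ω) (h : ∀ ω, P ω → 1 ≤ f ω) :
    Pr P ≤ Ex f := by
  classical
  refine Ex_mono fun ω => ?_
  by_cases hP : P ω
  · simp [hP, h ω hP]
  · simp [hP, h0 ω]

lemma Pr_or (P Q : Ω → Prop) : Pr (fun ω => P ω ∨ Q ω) ≤ Pr P + Pr Q := by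
  classical
  unfold Pr
  rw [← Ex_add]
  refine Ex_mono fun ω => ?_
  by_cases hP : P ω <;> by_cases hQ : Q ω <;> simp [hP, hQ]

lemma Pr_exists_le {ι : Type*} (s : Finset ι) (P : ι → Ω → Prop) :
    Pr (fun ω => ∃ i ∈ s, P i ω) ≤ ∑ i ∈ s, Pr (P i) := by
  classical
  calc Pr (fun ω => ∃ i ∈ s, P i ω)
      ≤ Ex (fun ω => ∑ i ∈ s, if P i ω then (1 : ℝ) else 0) := by
        refine Pr_le_Ex (fun ω => Finset.sum_nonneg fun i _ => by positivity) ?_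
        rintro ω ⟨i, hi, hP⟩
        calc (1 : ℝ) = if P i ω then 1 else 0 := by simp [hP]
          _ ≤ _ := Finset.single_le_sum (f := fun i => if P i ω then (1 : ℝ) else 0)
            (fun i _ => by positivity) hi
    _ = ∑ i ∈ s, Pr (P i) := Ex_sum _ _

lemma Pr_add_Pr_not [Nonempty Ω] (P : Ω → Prop) : Pr P + Pr (fun ω => ¬ P ω) = 1 := by
  classical
  rw [Pr_eq_Ex, Pr_eq_Ex, ← Ex_add, ← Ex_one (Ω := Ω)]
  congr 1
  funext ω
  by_cases hP : P ω <;> simp [hP, Ex_one]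

end FiniteProbability

section RandomOrdering

/-- The elements occupying the positions in `X`. -/
def occupants {E : Type*} [Fintype E] (σ : Fin (Fintype.card E) ≃ E)
    (X : Finset (Fin (Fintype.card E))) : Finset E :=
  X.map σ.toEmbedding

lemma mem_occupants {E : Type*} [Fintype E] {σ : Fin (Fintype.card E) ≃ E}
    {X : Finset (Fin (Fintype.card E))} {e : E} :
    e ∈ occupants σ X ↔ σ.symm e ∈ X := by
  simp [occupants, Finset.mem_map_equiv]

variable {E : Type*} [Fintype E] [DecidableEq E]

/-- If `A` does not depend on the relative order of the elements outside `Q`, then all elements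
outside `Q` are equally likely to occupy a position in `X`. -/
lemma card_mul_Pr_and_mem (A : (Fin (Fintype.card E) ≃ E) → Prop) (Q : Finset E)
    (hA : ∀ σ, ∀ e ∉ Q, ∀ e' ∉ Q, A σ → A (σ.trans (Equiv.swap e e')))
    (X : Finset (Fin (Fintype.card E))) {e : E} (he : e ∉ Q) :
    ((Fintype.card E : ℝ) - Q.card) * Pr (fun σ => A σ ∧ σ.symm e ∈ X) =
      open Classical in
      Ex (fun σ : Fin (Fintype.card E) ≃ E =>
        if A σ then ((Qᶜ.filter fun e' => σ.symm e' ∈ X).card : ℝ) else 0) := by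
  classical
  have key : ∀ e' ∈ Qᶜ, Pr (fun σ => A σ ∧ σ.symm e' ∈ X) = Pr (fun σ => A σ ∧ σ.symm e ∈ X) := by
    intro e' he'
    have he' : e' ∉ Q := by simpa using he'
    rw [Pr_eq_Ex, Pr_eq_Ex, ← Ex_comp_equiv _ ((Equiv.refl _).equivCongr (Equiv.swap e e'))]
    congr 1
    funext σ
    have h1 : A ((Equiv.refl _).equivCongr (Equiv.swap e e') σ) ↔ A σ := by
      constructor
      · intro h
        have := hA _ e he e' he' h
        convert this using 1
        ext x
        simp [Equiv.equivCongr]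
      · intro h
        exact hA _ e he e' he' h
    have h2 : ((Equiv.refl _).equivCongr (Equiv.swap e e') σ).symm e' = σ.symm e := by
      simp [Equiv.equivCongr]
    simp only [h1, h2]
  have hcard : ((Qᶜ.card : ℕ) : ℝ) = (Fintype.card E : ℝ) - Q.card := by
    rw [Finset.card_compl, Nat.cast_sub (Finset.card_le_univ Q)]
  rw [← hcard, ← nsmul_eq_mul, ← Finset.sum_const, ← Finset.sum_congr rfl key]
  unfold Pr
  rw [← Ex_sum]
  congr 1
  funext σ
  by_cases h : A σ
  · simp [h]
  · simp [h]

lemma Pr_forall_mem (X : Finset (Fin (Fintype.card E))) (T : Finset E) :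
    Pr (fun σ : Fin (Fintype.card E) ≃ E => ∀ e ∈ T, σ.symm e ∈ X) =
      ∏ i ∈ Finset.range T.card, (((X.card : ℝ) - i) / ((Fintype.card E : ℝ) - i)) := by
  classical
  induction T using Finset.induction_on with
  | empty =>
    have : Nonempty (Fin (Fintype.card E) ≃ E) := ⟨(Fintype.equivFin E).symm⟩
    simp [Pr, Ex_one]
  | insert e T he ih =>
    rw [Finset.card_insert_of_notMem he, Finset.prod_range_succ, ← ih]
    have hlt : (T.card : ℝ) < Fintype.card E := by
      exact_mod_cast Finset.card_lt_univ_of_notMem he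
    have hne : (Fintype.card E : ℝ) - T.card ≠ 0 := by linarith
    have h := card_mul_Pr_and_mem
      (fun σ : Fin (Fintype.card E) ≃ E => ∀ e ∈ T, σ.symm e ∈ X) T (by
        intro σ e he e' he' h x hx
        have h1 : x ≠ e := fun h => he (h ▸ hx)
        have h2 : x ≠ e' := fun h => he' (h ▸ hx)
        simpa [Equiv.swap_apply_of_ne_of_ne h1 h2] using h x hx) X he
    have h3 : (fun σ : Fin (Fintype.card E) ≃ E => ∀ x ∈ insert e T, σ.symm x ∈ X) =
        fun σ => (∀ x ∈ T, σ.symm x ∈ X) ∧ σ.symm e ∈ X := by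
      funext σ
      simp [and_comm]
    rw [h3, mul_div_assoc', eq_div_iff hne, mul_comm, h, mul_comm]
    unfold Pr
    rw [← Ex_const_mul]
    congr 1
    funext σ
    by_cases hσ : ∀ x ∈ T, σ.symm x ∈ X
    · have h4 : (Tᶜ.filter fun e' => σ.symm e' ∈ X) = occupants σ X \ T := by
        ext x
        simp [mem_occupants, and_comm]
      have h5 : T ⊆ occupants σ X := fun x hx => mem_occupants.2 (hσ x hx)
      rw [if_pos hσ, if_pos hσ, h4, Finset.card_sdiff_of_subset h5,
        Nat.cast_sub (Finset.card_le_card h5)]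
      simp [occupants]
    · simp [hσ]

lemma Pr_forall_mem_le (X : Finset (Fin (Fintype.card E))) (T : Finset E) :
    Pr (fun σ : Fin (Fintype.card E) ≃ E => ∀ e ∈ T, σ.symm e ∈ X) ≤
      ((X.card : ℝ) / Fintype.card E) ^ T.card := by
  classical
  have hX : (X.card : ℝ) ≤ Fintype.card E := by
    exact_mod_cast (Finset.card_le_univ X).trans_eq (Fintype.card_fin _)
  by_cases hT : T.card ≤ X.card
  · rw [Pr_forall_mem, ← Finset.card_range T.card, ← Finset.prod_const, Finset.card_range]
    have hi : ∀ i ∈ Finset.range T.card, (i : ℝ) < X.card := fun i hi => by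
      exact_mod_cast (Finset.mem_range.1 hi).trans_le hT
    refine Finset.prod_le_prod (fun i h => ?_) fun i h => ?_
    · exact div_nonneg (by linarith [hi i h]) (by linarith [hi i h])
    · have := hi i h
      have hi0 : (0 : ℝ) ≤ i := by positivity
      rw [div_le_div_iff₀ (by linarith) (by linarith)]
      nlinarith
  · rw [Pr_forall_mem, Finset.prod_eq_zero (i := X.card) (by simpa using hT) (by simp)]
    positivity

lemma Pr_forall_mem_and_le (X Y : Finset (Fin (Fintype.card E))) (T R : Finset E)
    (hTR : Disjoint T R) {D : ℝ} (hD : 0 < D)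
    (hDle : D ≤ (Fintype.card E : ℝ) - T.card - R.card) :
    Pr (fun σ : Fin (Fintype.card E) ≃ E =>
        (∀ e ∈ R, σ.symm e ∈ Y) ∧ ∀ e ∈ T, σ.symm e ∈ X) ≤
      ((Y.card : ℝ) / D) ^ R.card * ((X.card : ℝ) / Fintype.card E) ^ T.card := by
  classical
  induction R using Finset.induction_on with
  | empty => simpa using Pr_forall_mem_le X T
  | insert e R he ih =>
    rw [Finset.card_insert_of_notMem he] at hDle ⊢
    rw [Finset.disjoint_insert_right] at hTR
    push_cast at hDle
    have ih := ih hTR.2 (by linarith)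
    have hQ : (((T ∪ R).card : ℕ) : ℝ) = T.card + R.card := by
      rw [Finset.card_union_of_disjoint hTR.2]; push_cast; rfl
    set A : (Fin (Fintype.card E) ≃ E) → Prop :=
      fun σ => (∀ e ∈ R, σ.symm e ∈ Y) ∧ ∀ e ∈ T, σ.symm e ∈ X with hAdef
    have h := card_mul_Pr_and_mem A (T ∪ R) (by
        intro σ e he e' he' h
        have hx : ∀ x ∈ T ∪ R, (σ.trans (Equiv.swap e e')).symm x = σ.symm x := by
          intro x hx
          have h1 : x ≠ e := fun h => he (h ▸ hx)
          have h2 : x ≠ e' := fun h => he' (h ▸ hx)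
          simp [Equiv.swap_apply_of_ne_of_ne h1 h2]
        refine ⟨fun x hxR => ?_, fun x hxT => ?_⟩
        · rw [hx x (Finset.mem_union_right _ hxR)]; exact h.1 x hxR
        · rw [hx x (Finset.mem_union_left _ hxT)]; exact h.2 x hxT) Y (e := e)
        (by simp [he, hTR.1])
    have h3 : (fun σ : Fin (Fintype.card E) ≃ E =>
        (∀ x ∈ insert e R, σ.symm x ∈ Y) ∧ ∀ x ∈ T, σ.symm x ∈ X) =
        fun σ => A σ ∧ σ.symm e ∈ Y := by
      funext σ
      simp only [Finset.forall_mem_insert, hAdef]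
      exact propext (by tauto)
    have h4 : ((Fintype.card E : ℝ) - (T ∪ R).card) * Pr (fun σ => A σ ∧ σ.symm e ∈ Y) ≤
        Y.card * Pr A := by
      rw [h]
      unfold Pr
      rw [← Ex_const_mul]
      refine Ex_mono fun σ => ?_
      by_cases hσ : A σ
      · simp only [hσ, if_true, mul_one]
        have : (((T ∪ R)ᶜ).filter fun e' => σ.symm e' ∈ Y) ⊆ occupants σ Y := by
          intro x hx
          exact mem_occupants.2 (Finset.mem_filter.1 hx).2
        have := Finset.card_le_card this
        simp only [occupants, Finset.card_map] at this
        exact_mod_cast this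
      · simp [hσ]
    rw [h3]
    have h5 : D * Pr (fun σ => A σ ∧ σ.symm e ∈ Y) ≤ Y.card * Pr A :=
      le_trans (mul_le_mul_of_nonneg_right (by rw [hQ]; linarith) (Pr_nonneg _)) h4
    calc Pr (fun σ => A σ ∧ σ.symm e ∈ Y) ≤ Y.card / D * Pr A := by
          rw [div_mul_eq_mul_div, le_div_iff₀ hD, mul_comm]; exact h5
      _ ≤ Y.card / D * (((Y.card : ℝ) / D) ^ R.card *
            ((X.card : ℝ) / Fintype.card E) ^ T.card) := by gcongr
      _ = _ := by ring

/-- Exponential moment bound for the number of elements of `F` at positions in `X`, jointly with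
an event `B`. -/
lemma Ex_pow_le (B : (Fin (Fintype.card E) ≃ E) → Prop) (X : Finset (Fin (Fintype.card E)))
    (F : Finset E) {c y : ℝ} (hy : 0 ≤ y)
    (hB : ∀ R ⊆ F, Pr (fun σ => B σ ∧ ∀ e ∈ R, σ.symm e ∈ X) ≤
      c * ((X.card : ℝ) / Fintype.card E) ^ R.card) :
    open Classical in
    Ex (fun σ => if B σ then (1 + y) ^ (F ∩ occupants σ X).card else 0) ≤
      c * (1 + y * ((X.card : ℝ) / Fintype.card E)) ^ F.card := by
  classical
  have h1 : ∀ σ, (if B σ then (1 + y) ^ (F ∩ occupants σ X).card else 0) =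
      ∑ R ∈ F.powerset, y ^ R.card * if (B σ ∧ ∀ e ∈ R, σ.symm e ∈ X) then (1 : ℝ) else 0 := by
    intro σ
    by_cases hσ : B σ
    · simp only [hσ, if_true, true_and, mul_ite, mul_one, mul_zero]
      rw [← Finset.sum_filter, add_comm 1 y]
      have : F.powerset.filter (fun R => ∀ e ∈ R, σ.symm e ∈ X) =
          (F ∩ occupants σ X).powerset := by
        ext R
        simp only [Finset.mem_filter, Finset.mem_powerset, Finset.subset_inter_iff]
        exact and_congr_right fun _ => forall₂_congr fun e _ => mem_occupants.symm
      rw [this, ← Finset.sum_pow_mul_eq_add_pow]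
      simp
    · simp [hσ]
  simp_rw [h1]
  rw [Ex_sum]
  simp_rw [Ex_const_mul]
  calc _ ≤ ∑ R ∈ F.powerset, y ^ R.card * (c * ((X.card : ℝ) / Fintype.card E) ^ R.card) := by
        refine Finset.sum_le_sum fun R hR => ?_
        have := hB R (Finset.mem_powerset.1 hR)
        rw [Pr_eq_Ex] at this
        exact mul_le_mul_of_nonneg_left this (by positivity)
    _ = c * ∑ R ∈ F.powerset, (y * ((X.card : ℝ) / Fintype.card E)) ^ R.card *
          1 ^ (F.card - R.card) := by
        rw [Finset.mul_sum]
        refine Finset.sum_congr rfl fun R _ => ?_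
        rw [mul_pow]; ring
    _ = _ := by rw [Finset.sum_pow_mul_eq_add_pow, add_comm]

/-- Upper tail bound. -/
lemma Pr_le_card_inter_occupants (X : Finset (Fin (Fintype.card E))) (F : Finset E) {y : ℝ}
    (hy : 0 ≤ y) (k : ℝ) :
    Pr (fun σ : Fin (Fintype.card E) ≃ E => k ≤ (F ∩ occupants σ X).card) ≤
      Real.exp (y * ((X.card : ℝ) / Fintype.card E) * F.card - k * Real.log (1 + y)) := by
  classical
  have h := Ex_pow_le (fun _ : Fin (Fintype.card E) ≃ E => True) X F (c := 1) hy (by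
    intro R _
    simpa using Pr_forall_mem_le X R)
  simp only [if_true, one_mul] at h
  have hlog : 0 ≤ Real.log (1 + y) := Real.log_nonneg (by linarith)
  calc Pr (fun σ : Fin (Fintype.card E) ≃ E => k ≤ (F ∩ occupants σ X).card)
      ≤ Ex (fun σ : Fin (Fintype.card E) ≃ E =>
          Real.exp (-(k * Real.log (1 + y))) * (1 + y) ^ (F ∩ occupants σ X).card) := by
        refine Pr_le_Ex (fun σ => by positivity) fun σ hσ => ?_
        rw [← Real.exp_log (show 0 < 1 + y by linarith), ← Real.exp_nat_mul, ← Real.exp_add,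
          Real.exp_log (show 0 < 1 + y by linarith)]
        apply Real.one_le_exp
        nlinarith
    _ ≤ Real.exp (-(k * Real.log (1 + y))) *
          Real.exp (y * ((X.card : ℝ) / Fintype.card E)) ^ F.card := by
        rw [Ex_const_mul]
        refine mul_le_mul_of_nonneg_left (h.trans ?_) (by positivity)
        gcongr
        rw [add_comm]
        exact Real.add_one_le_exp _
    _ = _ := by
        rw [← Real.exp_nat_mul, ← Real.exp_add]
        congr 1; ring

/-- Lower tail bound, jointly with an event `B`. -/
lemma Pr_card_inter_occupants_le (B : (Fin (Fintype.card E) ≃ E) → Prop)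
    (X : Finset (Fin (Fintype.card E))) (hE : 0 < Fintype.card E)
    (F : Finset E) {c y : ℝ} (hc : 0 ≤ c) (hy : 0 ≤ y)
    (hB : ∀ R ⊆ F, Pr (fun σ => B σ ∧ ∀ e ∈ R, σ.symm e ∈ Xᶜ) ≤
      c * ((Xᶜ.card : ℝ) / Fintype.card E) ^ R.card) (k : ℝ) :
    Pr (fun σ => B σ ∧ ((F ∩ occupants σ X).card : ℝ) ≤ k) ≤
      c * Real.exp (k * Real.log (1 + y) -
        y / (1 + y) * ((X.card : ℝ) / Fintype.card E) * F.card) := by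
  classical
  have h := Ex_pow_le B Xᶜ F hy hB
  have hlog : 0 ≤ Real.log (1 + y) := Real.log_nonneg (by linarith)
  have hy1 : 0 < 1 + y := by linarith
  set p : ℝ := (X.card : ℝ) / Fintype.card E with hp
  have hp' : ((Xᶜ.card : ℕ) : ℝ) / Fintype.card E = 1 - p := by
    rw [Finset.card_compl, Nat.cast_sub (Finset.card_le_univ X), hp, Fintype.card_fin]
    field_simp
  rw [hp'] at h
  have hpow : ∀ m : ℕ, (1 + y) ^ m = Real.exp (m * Real.log (1 + y)) := fun m => by
    rw [Real.exp_nat_mul, Real.exp_log hy1]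
  have hsplit : ∀ σ : Fin (Fintype.card E) ≃ E,
      ((F ∩ occupants σ X).card : ℝ) + (F ∩ occupants σ Xᶜ).card = F.card := by
    intro σ
    have : F ∩ occupants σ Xᶜ = F \ occupants σ X := by
      ext x; simp [mem_occupants]
    rw [this]
    exact_mod_cast Finset.card_inter_add_card_sdiff F (occupants σ X)
  calc Pr (fun σ => B σ ∧ ((F ∩ occupants σ X).card : ℝ) ≤ k)
      ≤ Ex (fun σ : Fin (Fintype.card E) ≃ E => Real.exp ((k - F.card) * Real.log (1 + y)) *
          if B σ then (1 + y) ^ (F ∩ occupants σ Xᶜ).card else 0) := by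
        refine Pr_le_Ex (fun σ => by positivity) ?_
        rintro σ ⟨hσ, hk⟩
        rw [if_pos hσ, hpow, ← Real.exp_add]
        apply Real.one_le_exp
        have := hsplit σ
        nlinarith
    _ ≤ Real.exp ((k - F.card) * Real.log (1 + y)) * (c * (1 + y * (1 - p)) ^ F.card) := by
        rw [Ex_const_mul]
        exact mul_le_mul_of_nonneg_left h (by positivity)
    _ ≤ Real.exp ((k - F.card) * Real.log (1 + y)) *
          (c * ((1 + y) ^ F.card * Real.exp (-(y / (1 + y) * p)) ^ F.card)) := by
        have h0 : 0 ≤ 1 + y * (1 - p) := by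
          rw [← hp']; positivity
        rw [← mul_pow]
        gcongr
        have h1 := Real.add_one_le_exp (-(y / (1 + y) * p))
        calc 1 + y * (1 - p) = (1 + y) * (-(y / (1 + y) * p) + 1) := by field_simp; ring
          _ ≤ _ := by gcongr
    _ = _ := by
        rw [hpow, ← Real.exp_nat_mul, mul_left_comm, ← Real.exp_add, ← Real.exp_add]
        congr 2; ring

end RandomOrdering

section Deterministic

/-- A failure of Tutte's condition on an even number of vertices, phrased as a labelling `c` of the
vertices outside `S` that is constant along edges and takes at least `|S| + 2` values. -/
lemma exists_labelling_of_not_isPerfectMatching {V : Type*} [Fintype V] [DecidableEq V]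
    (G : SimpleGraph V) (hV : Even (Fintype.card V)) (h : ∀ M : G.Subgraph, ¬ M.IsPerfectMatching) :
    ∃ (S : Finset V) (c : V → V),
      (∀ u ∉ S, ∀ v ∉ S, G.Adj u v → c u = c v) ∧ S.card + 2 ≤ (Sᶜ.image c).card := by
  classical
  obtain ⟨u, hu⟩ : ∃ u, G.IsTutteViolator u := by
    by_contra! hcon
    obtain ⟨M, hM⟩ := SimpleGraph.tutte.2 hcon
    exact h M hM
  set K := ((⊤ : G.Subgraph).deleteVerts u).coe with hK
  have hu : u.ncard < K.oddComponents.ncard := hu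
  have hmem : ∀ v, v ∈ ((⊤ : G.Subgraph).deleteVerts u).verts ↔ v ∉ u := by simp
  let S : Finset V := u.toFinset
  have hS : ∀ v, v ∈ S ↔ v ∈ u := by simp [S]
  let c : V → V := fun v =>
    if hv : v ∉ u then ((K.connectedComponentMk ⟨v, (hmem v).2 hv⟩).out : _) else v
  have hc : ∀ v (hv : v ∉ u), c v = (K.connectedComponentMk ⟨v, (hmem v).2 hv⟩).out := by
    intro v hv
    simp only [c, dif_pos hv]
  refine ⟨S, c, ?_, ?_⟩
  · intro x hx y hy hxy
    rw [hS] at hx hy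
    rw [hc x hx, hc y hy]
    have : K.Adj ⟨x, (hmem x).2 hx⟩ ⟨y, (hmem y).2 hy⟩ := by
      simp [hK, hx, hy, hxy]
    rw [SimpleGraph.ConnectedComponent.connectedComponentMk_eq_of_adj this]
  · have hSc : S.card = u.ncard := by rw [Set.ncard_eq_toFinset_card']
    have hle : K.oddComponents.ncard ≤ (Sᶜ.image c).card := by
      calc K.oddComponents.ncard ≤ Nat.card K.ConnectedComponent := Set.ncard_le_card _
        _ = Fintype.card K.ConnectedComponent := Nat.card_eq_fintype_card
        _ ≤ (Sᶜ.image c).card := by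
          rw [← Finset.card_univ]
          refine Finset.card_le_card_of_injOn (fun C => (C.out : _)) ?_ ?_
          · intro C _
            have hv : (C.out : V) ∉ u := (hmem _).1 C.out.2
            simp only [Finset.coe_image, Set.mem_image, Finset.mem_coe, Finset.mem_compl, hS]
            refine ⟨C.out, hv, ?_⟩
            rw [hc _ hv]
            congr 2
            exact C.out_eq
          · intro C _ C' _ hCC
            have := Subtype.ext hCC
            rw [← C.out_eq, ← C'.out_eq, this]
    have hpar := SimpleGraph.odd_ncard_oddComponents (G := K)
    have hcard : Nat.card ((⊤ : G.Subgraph).deleteVerts u).verts + u.ncard = Fintype.card V := by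
      rw [← Nat.card_eq_fintype_card, ← Set.ncard_add_ncard_compl u, add_comm]
      congr 1
      rw [Nat.card_coe_set_eq]
      congr 1
      ext v
      simp
    rw [hSc]
    grind

/-- The number of neighbours of `v` in `B`. -/
def degIn {V : Type*} (G : SimpleGraph V) (v : V) (B : Finset V) : ℕ :=
  open Classical in (B.filter (G.Adj v)).card

lemma deg_eq_degIn {V : Type*} [Fintype V] (G : SimpleGraph V) (v : V) :
    deg G v = degIn G v Finset.univ := by
  classical
  rw [deg, degIn, Set.ncard_eq_toFinset_card']
  congr 1
  ext w
  simp

lemma degIn_mono {V : Type*} {G G' : SimpleGraph V} (h : G ≤ G') (v : V) {B B' : Finset V}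
    (hB : B ⊆ B') : degIn G v B ≤ degIn G' v B' := by
  classical
  refine Finset.card_le_card fun w hw => ?_
  rw [Finset.mem_filter] at hw ⊢
  exact ⟨hB hw.1, h hw.2⟩

lemma degIn_union_le {V : Type*} [DecidableEq V] (G : SimpleGraph V) (v : V) (B B' : Finset V) :
    degIn G v (B ∪ B') ≤ degIn G v B + degIn G v B' := by
  classical
  unfold degIn
  rw [Finset.filter_union]
  exact Finset.card_union_le _ _

lemma deg_mono {V : Type*} [Fintype V] {G G' : SimpleGraph V} (h : G ≤ G') (v : V) :
    deg G v ≤ deg G' v := by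
  rw [deg_eq_degIn, deg_eq_degIn]
  exact degIn_mono h v subset_rfl

lemma deg_le_deg_sdiff_add {V : Type*} [Fintype V] (G H : SimpleGraph V) (v : V) :
    deg G v ≤ deg (G \ H) v + deg H v := by
  classical
  simp only [deg_eq_degIn, degIn]
  refine le_trans (Finset.card_le_card fun w hw => ?_) (Finset.card_union_le _ _)
  simp only [Finset.mem_filter, Finset.mem_union, Finset.mem_univ, true_and,
    SimpleGraph.sdiff_adj] at hw ⊢
  tauto

/-- A family of nonnegative weights either has a subfamily of total weight at least `x` and at most
half of the total, or is dominated by a single weight. -/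
lemma exists_subset_sum_or_dominant {ι : Type*} [DecidableEq ι] (Q : Finset ι) (w : ι → ℝ)
    {x : ℝ} (hx : 0 < x) (hQ : 4 * x ≤ ∑ i ∈ Q, w i) :
    (∃ I ⊆ Q, x ≤ ∑ i ∈ I, w i ∧ 2 * ∑ i ∈ I, w i ≤ ∑ i ∈ Q, w i) ∨
      ∃ i ∈ Q, ∑ j ∈ Q.erase i, w j < x := by
  set W := ∑ i ∈ Q, w i with hW
  obtain ⟨I, hI, hmax⟩ := Finset.exists_max_image
    (Q.powerset.filter fun I => 2 * ∑ i ∈ I, w i ≤ W) (fun I => ∑ i ∈ I, w i)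
    ⟨∅, by simp; linarith⟩
  simp only [Finset.mem_filter, Finset.mem_powerset] at hI hmax
  by_cases hxI : x ≤ ∑ i ∈ I, w i
  · exact Or.inl ⟨I, hI.1, hxI, hI.2⟩
  push Not at hxI
  right
  have hsplit : ∑ i ∈ Q \ I, w i + ∑ i ∈ I, w i = W := Finset.sum_sdiff hI.1
  obtain ⟨i, hi, hwi⟩ : ∃ i ∈ Q \ I, 0 < w i := by
    apply Finset.exists_lt_of_sum_lt (f := fun _ => (0 : ℝ))
    rw [Finset.sum_const_zero]
    linarith
  rw [Finset.mem_sdiff] at hi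
  have hbig : W < 2 * (w i + ∑ j ∈ I, w j) := by
    by_contra! hcon
    have h1 := hmax (insert i I) ⟨Finset.insert_subset hi.1 hI.1, by
      rw [Finset.sum_insert hi.2]; exact hcon⟩
    rw [Finset.sum_insert hi.2] at h1
    linarith
  have hw2 : W < 2 * w i := by
    by_contra! hcon
    have h2 := hmax {i} ⟨by simpa using hi.1, by simpa using hcon⟩
    rw [Finset.sum_singleton] at h2
    linarith
  refine ⟨i, hi.1, ?_⟩
  have herase := Finset.add_sum_erase Q w hi.1
  have h3 := hmax (Q.erase i) ⟨Finset.erase_subset _ _, by linarith⟩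
  linarith

/-- The properties of a pair of graphs `Gm ≤ Gp` that force every graph in between without
isolated vertices to be resilient. -/
structure Pseudorandom {V : Type*} [Fintype V] (Gm Gp : SimpleGraph V) (ε γ d : ℝ) (t : ℕ) :
    Prop where
  sparse : ∀ X : Finset V, (X.card : ℝ) ≤ γ * Fintype.card V →
    ∑ v ∈ X, (degIn Gp v X : ℝ) ≤ ε / 100 * (X.card * d)
  few_small : ((Finset.univ.filter fun v => (deg Gm v : ℝ) < (1 - ε / 5) * d).card : ℝ) ≤
    γ / 8 * Fintype.card V
  uniform : ∀ T B : Finset V, Disjoint T B → T.card = t →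
    (B.card : ℝ) ≤ (1 / 2 + ε / 20) * Fintype.card V →
    ∑ v ∈ T, (degIn Gp v B : ℝ) ≤ (1 / 2 + ε / 4) * (t * d)
  tiny_adj : ∀ u v, (deg Gm u : ℝ) < d / 100 → (deg Gm v : ℝ) < d / 100 → ¬ Gp.Adj u v
  tiny_common : ∀ u v, u ≠ v → (deg Gm u : ℝ) < d / 100 → (deg Gm v : ℝ) < d / 100 →
    ∀ w, Gp.Adj u w → ¬ Gp.Adj v w
  tiny_path : ∀ u v, (deg Gm u : ℝ) < d / 100 → (deg Gm v : ℝ) < d / 100 →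
    ∀ x w y, [u, v, x, w, y].Nodup → Gp.Adj u x → Gp.Adj x w → Gp.Adj y w → ¬ Gp.Adj v y

section

variable {V : Type*} [Fintype V] [DecidableEq V] {Gm Gp G G' : SimpleGraph V} {ε γ d : ℝ} {t : ℕ}

/-- A small set is not a union of more than `|S|` classes of a labelling. -/
lemma Pseudorandom.no_small_union (hP : Pseudorandom Gm Gp ε γ d t) (hd : 1000 ≤ d)
    (hε0 : 0 < ε) (hε : ε ≤ 1 / 10) (hm : Gm ≤ G) (hp : G ≤ Gp) (hG' : G' ≤ G)
    (hmin : ∀ v, 1 ≤ deg G v) (hdeg : ∀ v, (1 / 2 + ε) * deg G v ≤ deg G' v)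
    (S : Finset V) (c : V → V) (hc : ∀ u ∉ S, ∀ v ∉ S, G'.Adj u v → c u = c v)
    (I : Finset V) (hI : I ⊆ Sᶜ.image c) (hcard : S.card + 1 ≤ I.card)
    (hsmall : ((Sᶜ.filter fun v => c v ∈ I).card : ℝ) ≤ γ / 2 * Fintype.card V) : False := by
  classical
  set A := Sᶜ.filter fun v => c v ∈ I with hA
  have memA : ∀ v, v ∈ A ↔ v ∉ S ∧ c v ∈ I := by simp [hA]
  set tiny : V → Prop := fun v => (deg Gm v : ℝ) < d / 100 with htiny
  have hf : ∀ v, ∃ w, G'.Adj v w := by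
    intro v
    have h1 : (1 : ℝ) ≤ deg G v := by exact_mod_cast hmin v
    have h2 : (0 : ℝ) < deg G' v := by nlinarith [hdeg v]
    have h3 : 0 < deg G' v := by exact_mod_cast h2
    rw [deg_eq_degIn, degIn, Finset.card_pos] at h3
    obtain ⟨w, hw⟩ := h3
    exact ⟨w, (Finset.mem_filter.1 hw).2⟩
  choose f hf using hf
  have hle : G' ≤ Gp := hG'.trans hp
  have hnt : ∀ u, tiny u → ∀ w, G'.Adj u w → ¬ tiny w := fun u hu w hw ht =>
    hP.tiny_adj u w hu ht (hle hw)
  set A1 := A.filter fun v => ¬ tiny v with hA1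
  set D := A.filter tiny with hD
  set D0 := D.filter fun u => f u ∈ S with hD0
  have htD : ∀ u ∈ D, tiny u := fun u hu => (Finset.mem_filter.1 hu).2
  have htD0 : ∀ u ∈ D0, tiny u := fun u hu => htD u (Finset.mem_filter.1 hu).1
  have hinj : Set.InjOn f D0 := by
    intro u hu v hv huv
    by_contra hne
    refine hP.tiny_common u v hne (htD0 u hu) (htD0 v hv) (f u) (hle (hf u)) ?_
    rw [huv]
    exact hle (hf v)
  set F0 := D0.image f with hF0
  have hF0S : F0 ⊆ S := by
    intro w hw
    obtain ⟨u, hu, rfl⟩ := Finset.mem_image.1 hw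
    exact (Finset.mem_filter.1 hu).2
  have hF0card : F0.card = D0.card := Finset.card_image_of_injOn hinj
  set S1 := S \ F0 with hS1
  have hS1card : S1.card + D0.card = S.card := by
    rw [← hF0card]
    exact Finset.card_sdiff_add_card_eq_card hF0S
  have hIle : I.card ≤ A1.card + D0.card := by
    calc I.card ≤ (A1.image c ∪ D0.image c).card := by
          refine Finset.card_le_card fun i hi => ?_
          obtain ⟨v, hv, rfl⟩ := Finset.mem_image.1 (hI hi)
          have hvS : v ∉ S := by simpa using hv
          have hvA : v ∈ A := (memA v).2 ⟨hvS, hi⟩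
          rw [Finset.mem_union]
          by_cases ht : tiny v
          · by_cases hfS : f v ∈ S
            · exact Or.inr (Finset.mem_image_of_mem _
                (Finset.mem_filter.2 ⟨Finset.mem_filter.2 ⟨hvA, ht⟩, hfS⟩))
            · have hcv := hc v hvS (f v) hfS (hf v)
              left
              rw [hcv]
              refine Finset.mem_image_of_mem _ (Finset.mem_filter.2 ⟨(memA _).2 ⟨hfS, ?_⟩, ?_⟩)
              · rw [← hcv]; exact hi
              · exact hnt v ht _ (hf v)
          · exact Or.inl (Finset.mem_image_of_mem _ (Finset.mem_filter.2 ⟨hvA, ht⟩))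
      _ ≤ (A1.image c).card + (D0.image c).card := Finset.card_union_le _ _
      _ ≤ _ := add_le_add Finset.card_image_le Finset.card_image_le
  have hlt : S1.card + 1 ≤ A1.card := by omega
  set X := A1 ∪ S1 with hX
  have hXcard : X.card ≤ 2 * A1.card := by
    have : X.card ≤ A1.card + S1.card := Finset.card_union_le A1 S1
    omega
  have hA1A : A1.card ≤ A.card := Finset.card_filter_le _ _
  have hA1A' : (A1.card : ℝ) ≤ A.card := by exact_mod_cast hA1A
  have hXcard' : (X.card : ℝ) ≤ 2 * A1.card := by exact_mod_cast hXcard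
  have hA1pos : (1 : ℝ) ≤ A1.card := by exact_mod_cast (by omega : 1 ≤ A1.card)
  have hlow : ∀ w ∈ A1, d / 200 - 2 ≤ (degIn Gp w X : ℝ) := by
    intro w hw
    have hwt : ¬ tiny w := (Finset.mem_filter.1 hw).2
    have hwA := (memA w).1 (Finset.mem_filter.1 hw).1
    have hD1 : degIn G' w D ≤ 1 := by
      refine Finset.card_le_one.2 fun a ha b hb => ?_
      rw [Finset.mem_filter] at ha hb
      by_contra hab
      exact hP.tiny_common a b hab (htD a ha.1) (htD b hb.1) w (hle ha.2.symm) (hle hb.2.symm)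
    have hF1 : degIn G' w F0 ≤ 1 := by
      refine Finset.card_le_one.2 fun x hx y hy => ?_
      rw [Finset.mem_filter] at hx hy
      obtain ⟨a, ha, rfl⟩ := Finset.mem_image.1 hx.1
      obtain ⟨b, hb, rfl⟩ := Finset.mem_image.1 hy.1
      by_contra hab
      have hta := htD0 a ha
      have htb := htD0 b hb
      have hfa := hnt a hta _ (hf a)
      have hfb := hnt b htb _ (hf b)
      refine hP.tiny_path a b hta htb (f a) w (f b) ?_ (hle (hf a)) (hle hx.2.symm)
        (hle hy.2.symm) (hle (hf b))
      have hne : ∀ p q, tiny p → ¬ tiny q → p ≠ q := fun p q h1 h2 h => h2 (h ▸ h1)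
      simp only [List.nodup_cons, List.mem_cons, List.not_mem_nil, or_false, not_or,
        List.nodup_nil, and_true, not_false_eq_true]
      exact ⟨⟨fun h => hab (congrArg f h), hne _ _ hta hfa, hne _ _ hta hwt, hne _ _ hta hfb⟩,
        ⟨hne _ _ htb hfa, hne _ _ htb hwt, hne _ _ htb hfb⟩,
        ⟨hx.2.ne', hab⟩, hy.2.ne⟩
    have hcover : degIn G' w Finset.univ ≤ degIn G' w (X ∪ (D ∪ F0)) := by
      refine Finset.card_le_card fun z hz => ?_
      rw [Finset.mem_filter] at hz ⊢
      refine ⟨?_, hz.2⟩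
      simp only [hX, hS1, Finset.mem_union, Finset.mem_sdiff, hA1, hD, Finset.mem_filter, memA]
      by_cases hzS : z ∈ S
      · tauto
      · have := hc w hwA.1 z hzS hz.2
        rw [← this]
        tauto
    have h1 := degIn_union_le G' w X (D ∪ F0)
    have h2 := degIn_union_le G' w D F0
    have h3 := degIn_mono hle w (subset_refl X)
    have h4 : deg G' w ≤ degIn Gp w X + 2 := by
      rw [deg_eq_degIn]; omega
    have h4' : (deg G' w : ℝ) ≤ degIn Gp w X + 2 := by exact_mod_cast h4
    have h5 : (deg Gm w : ℝ) ≤ deg G w := by exact_mod_cast deg_mono hm w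
    have h6 : d / 100 ≤ deg Gm w := not_lt.1 hwt
    have h7 := hdeg w
    have h8 : 1 / 2 * (deg G w : ℝ) ≤ (1 / 2 + ε) * deg G w :=
      mul_le_mul_of_nonneg_right (by linarith) (Nat.cast_nonneg _)
    linarith
  have hsum : (A1.card : ℝ) * (d / 200 - 2) ≤ ∑ v ∈ X, (degIn Gp v X : ℝ) := by
    rw [← nsmul_eq_mul]
    refine (Finset.card_nsmul_le_sum _ _ _ hlow).trans ?_
    exact Finset.sum_le_sum_of_subset_of_nonneg Finset.subset_union_left
      fun _ _ _ => by positivity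
  have hsp := hP.sparse X (by linarith)
  have h1 : (X.card : ℝ) * d ≤ 2 * A1.card * d :=
    mul_le_mul_of_nonneg_right hXcard' (by linarith)
  have h2 : ε / 100 * (X.card * d) ≤ 1 / 1000 * (X.card * d) :=
    mul_le_mul_of_nonneg_right (by linarith) (mul_nonneg (Nat.cast_nonneg _) (by linarith))
  have h3 : 0 < (A1.card : ℝ) * (3 / 1000 * d - 2) := mul_pos (by linarith) (by linarith)
  linarith

/-- A linear-sized set cannot send almost all of its edges to half of the vertices. -/
lemma Pseudorandom.no_large_set (hP : Pseudorandom Gm Gp ε γ d t) (hd : 0 < d)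
    (hε0 : 0 < ε) (hε : ε ≤ 1 / 10) (hm : Gm ≤ G) (hp : G ≤ Gp) (hG' : G' ≤ G)
    (hdeg : ∀ v, (1 / 2 + ε) * deg G v ≤ deg G' v) (ht0 : 0 < t)
    (ht : (t : ℝ) ≤ γ / 4 * Fintype.card V) {K : ℝ} (hK : K ≤ ε / 4 * d)
    (T0 B0 : Finset V) (hT0 : γ / 2 * Fintype.card V ≤ T0.card)
    (hB0 : (B0.card : ℝ) ≤ (1 / 2 + ε / 20) * Fintype.card V)
    (hout : ∀ v ∈ T0, (degIn G' v B0ᶜ : ℝ) ≤ K) : False := by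
  classical
  set L := Finset.univ.filter fun v => (deg Gm v : ℝ) < (1 - ε / 5) * d with hL
  have hV : (0 : ℝ) ≤ Fintype.card V := by positivity
  have hcard : t ≤ (T0 \ L).card := by
    have h1 : T0.card ≤ (T0 \ L).card + L.card := by
      have := Finset.le_card_sdiff L T0
      omega
    have h1' : (T0.card : ℝ) ≤ (T0 \ L).card + L.card := by exact_mod_cast h1
    have h2 := hP.few_small
    have h3 : (t : ℝ) ≤ (T0 \ L).card := by nlinarith
    exact_mod_cast h3
  obtain ⟨T, hT, hTcard⟩ := Finset.exists_subset_card_eq hcard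
  have hTcard' : (T.card : ℝ) = t := by exact_mod_cast hTcard
  have h1 := hP.uniform T (B0 \ T) Finset.disjoint_sdiff hTcard
    (le_trans (by exact_mod_cast Finset.card_le_card Finset.sdiff_subset) hB0)
  have h2 := hP.sparse T (by rw [hTcard']; nlinarith)
  have hle : G' ≤ Gp := hG'.trans hp
  have h3 : ∀ v ∈ T, (1 / 2 + ε) * ((1 - ε / 5) * d) - K ≤
      (degIn Gp v (B0 \ T) : ℝ) + degIn Gp v T := by
    intro v hv
    have hvT := Finset.mem_sdiff.1 (hT hv)
    have h4 : degIn G' v Finset.univ ≤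
        degIn Gp v (B0 \ T) + degIn Gp v T + degIn G' v B0ᶜ := by
      have e1 : degIn G' v Finset.univ ≤ degIn G' v ((B0 \ T ∪ T) ∪ B0ᶜ) := by
        refine degIn_mono le_rfl v fun x _ => ?_
        simp only [Finset.mem_union, Finset.mem_sdiff, Finset.mem_compl]
        tauto
      have e2 := degIn_union_le G' v (B0 \ T ∪ T) B0ᶜ
      have e3 := degIn_union_le G' v (B0 \ T) T
      have e4 := degIn_mono hle v (subset_refl (B0 \ T))
      have e5 := degIn_mono hle v (subset_refl T)
      omega
    rw [← deg_eq_degIn] at h4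
    have h4' : (deg G' v : ℝ) ≤ degIn Gp v (B0 \ T) + degIn Gp v T + degIn G' v B0ᶜ := by
      exact_mod_cast h4
    have h5 : (deg Gm v : ℝ) ≤ deg G v := by exact_mod_cast deg_mono hm v
    have h6 : (1 - ε / 5) * d ≤ deg Gm v := by
      by_contra! hcon
      exact hvT.2 (Finset.mem_filter.2 ⟨Finset.mem_univ _, hcon⟩)
    have h7 := hdeg v
    have h8 := hout v hvT.1
    nlinarith
  have h4 := Finset.card_nsmul_le_sum _ _ _ h3
  rw [Finset.sum_add_distrib, nsmul_eq_mul, hTcard'] at h4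
  rw [hTcard'] at h2
  have ht0' : (0 : ℝ) < t := by exact_mod_cast ht0
  have h5 : (1 / 2 + ε) * ((1 - ε / 5) * d) - K > (1 / 2 + ε / 4) * d + ε / 100 * d := by
    have : ε * d ≤ 1 / 10 * d := by gcongr
    nlinarith [mul_pos hε0 hd, mul_pos (mul_pos hε0 hd) hε0]
  nlinarith

theorem Pseudorandom.hasNearPerfectMatching_of_deg (hP : Pseudorandom Gm Gp ε γ d t)
    (hd : 1000 ≤ d) (hε0 : 0 < ε) (hε : ε ≤ 1 / 10) (hm : Gm ≤ G) (hp : G ≤ Gp) (hG' : G' ≤ G)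
    (hmin : ∀ v, 1 ≤ deg G v) (hdeg : ∀ v, (1 / 2 + ε) * deg G v ≤ deg G' v)
    (ht0 : 0 < t) (hγ : 0 < γ) (hγε : γ ≤ ε / 20)
    (ht : (t : ℝ) ≤ γ / 4 * Fintype.card V) (hK : 40 / ε ≤ ε / 4 * d)
    (hV : Even (Fintype.card V)) : HasNearPerfectMatching G' := by
  classical
  by_contra hcon
  obtain ⟨S, c, hc, hcard⟩ := exists_labelling_of_not_isPerfectMatching G' hV (by
    intro M hM
    refine hcon ⟨M, hM.1, ?_⟩
    rw [SimpleGraph.Subgraph.isSpanning_iff.1 hM.2]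
    simp)
  set N : ℝ := (Fintype.card V : ℝ) with hN
  have hN0 : 0 < N := by
    have : (0 : ℝ) < t := by exact_mod_cast ht0
    by_contra! h
    nlinarith
  set Q := Sᶜ.image c with hQ
  set cls : V → Finset V := fun i => Sᶜ.filter fun v => c v = i with hcls
  have hSN : (Sᶜ.card : ℝ) = N - S.card := by
    rw [Finset.card_compl, Nat.cast_sub (Finset.card_le_univ S)]
  have hcard' : (S.card : ℝ) + 2 ≤ Q.card := by exact_mod_cast hcard
  have hQle : (Q.card : ℝ) ≤ N - S.card := by
    rw [← hSN]
    exact_mod_cast Finset.card_image_le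
  have hunion : ∀ I ⊆ Q, ∑ i ∈ I, ((cls i).card : ℝ) =
      (Sᶜ.filter fun v => c v ∈ I).card := by
    intro I hI
    rw [Finset.card_eq_sum_card_fiberwise (f := c) (t := I)]
    · push_cast
      refine Finset.sum_congr rfl fun i hi => ?_
      rw [Finset.filter_filter]
      congr 2
      ext v
      simp only [hcls, Finset.mem_filter, Finset.mem_compl]
      constructor
      · rintro ⟨h1, h2⟩; exact ⟨h1, h2 ▸ hi, h2⟩
      · rintro ⟨h1, h2, h3⟩; exact ⟨h1, h3⟩
    · intro v hv
      exact (Finset.mem_filter.1 hv).2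
  have htotal : ∑ i ∈ Q, ((cls i).card : ℝ) = N - S.card := by
    rw [hunion Q subset_rfl, ← hSN, Finset.filter_true_of_mem]
    intro v hv
    exact Finset.mem_image_of_mem _ hv
  have hd0 : 0 < d := by linarith
  by_cases hS : ε / 20 * N ≤ S.card
  · set Qs := Q.filter fun i => ((cls i).card : ℝ) ≤ 40 / ε with hQs
    have hrep : ∀ i ∈ Q, ∃ v, v ∉ S ∧ c v = i := by
      intro i hi
      obtain ⟨v, hv, rfl⟩ := Finset.mem_image.1 hi
      exact ⟨v, by simpa using hv, rfl⟩
    choose! r hrS hrc using hrep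
    have hsub : Qs ⊆ Q := Finset.filter_subset _ _
    have hinj : Set.InjOn r Qs := by
      intro i hi j hj hij
      rw [← hrc i (hsub hi), ← hrc j (hsub hj), hij]
    refine hP.no_large_set hd0 hε0 hε hm hp hG' hdeg ht0 ht hK (Qs.image r) S ?_ ?_ ?_
    · rw [Finset.card_image_of_injOn hinj]
      have h1 : ((Q \ Qs).card : ℝ) * (40 / ε) ≤ N := by
        rw [← nsmul_eq_mul]
        calc _ ≤ ∑ i ∈ Q \ Qs, ((cls i).card : ℝ) := by
              refine Finset.card_nsmul_le_sum _ _ _ fun i hi => ?_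
              rw [Finset.mem_sdiff] at hi
              by_contra! h
              exact hi.2 (Finset.mem_filter.2 ⟨hi.1, h.le⟩)
          _ ≤ ∑ i ∈ Q, ((cls i).card : ℝ) :=
              Finset.sum_le_sum_of_subset_of_nonneg Finset.sdiff_subset
                fun _ _ _ => by positivity
          _ ≤ N := by rw [htotal]; linarith [(by positivity : (0 : ℝ) ≤ S.card)]
      have h2 : ((Q \ Qs).card : ℝ) ≤ ε / 40 * N := by
        rw [mul_div_assoc', div_le_iff₀ hε0] at h1
        linarith
      have h3 : ((Q \ Qs).card : ℝ) + Qs.card = Q.card := by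
        exact_mod_cast Finset.card_sdiff_add_card_eq_card hsub
      nlinarith
    · nlinarith
    · intro v hv
      obtain ⟨i, hi, rfl⟩ := Finset.mem_image.1 hv
      have hiQ := hsub hi
      refine le_trans ?_ (Finset.mem_filter.1 hi).2
      unfold degIn
      exact_mod_cast Finset.card_le_card fun w hw => by
        rw [Finset.mem_filter] at hw
        refine Finset.mem_filter.2 ⟨hw.1, ?_⟩
        rw [← hc (r i) (hrS i hiQ) w (by simpa using hw.1) hw.2, hrc i hiQ]
  · push Not at hS
    rcases exists_subset_sum_or_dominant Q (fun i => ((cls i).card : ℝ)) (x := γ / 2 * N) (by positivity) (by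
        rw [htotal]; nlinarith) with ⟨I, hI, h1, h2⟩ | ⟨i, hi, h1⟩
    · rw [hunion I hI] at h1 h2
      rw [htotal] at h2
      refine hP.no_large_set hd0 hε0 hε hm hp hG' hdeg ht0 ht hK
        (Sᶜ.filter fun v => c v ∈ I) ((Sᶜ.filter fun v => c v ∈ I) ∪ S) h1 ?_ ?_
      · have := Finset.card_union_le (Sᶜ.filter fun v => c v ∈ I) S
        have h3 : (((Sᶜ.filter fun v => c v ∈ I) ∪ S).card : ℝ) ≤
            (Sᶜ.filter fun v => c v ∈ I).card + S.card := by exact_mod_cast this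
        have : (0 : ℝ) ≤ S.card := by positivity
        linarith
      · intro v hv
        have h0 : degIn G' v ((Sᶜ.filter fun v => c v ∈ I) ∪ S)ᶜ = 0 := by
          unfold degIn
          rw [Finset.card_eq_zero, Finset.filter_eq_empty_iff]
          intro w hw hadj
          simp only [Finset.mem_compl, Finset.mem_union, Finset.mem_filter, not_or,
            not_and] at hw hv
          exact hw.1 hw.2 (by rw [← hc v hv.1 w hw.2 hadj]; exact hv.2)
        rw [h0]
        simp only [Nat.cast_zero]
        positivity
    · rw [hunion _ (Finset.erase_subset _ _)] at h1
      refine hP.no_small_union hd hε0 hε hm hp hG' hmin hdeg S c hc (Q.erase i)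
        (Finset.erase_subset _ _) ?_ h1.le
      rw [Finset.card_erase_of_mem hi]
      omega

theorem Pseudorandom.resilient (hP : Pseudorandom Gm Gp ε γ d t)
    (hd : 1000 ≤ d) (hε0 : 0 < ε) (hε : ε ≤ 1 / 10) (hm : Gm ≤ G) (hp : G ≤ Gp)
    (hmin : ∀ v, 1 ≤ deg G v) (ht0 : 0 < t) (hγ : 0 < γ) (hγε : γ ≤ ε / 20)
    (ht : (t : ℝ) ≤ γ / 4 * Fintype.card V) (hK : 40 / ε ≤ ε / 4 * d)
    (hV : Even (Fintype.card V)) : Resilient G (1 / 2 - ε) HasNearPerfectMatching := by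
  intro H _ hH
  refine hP.hasNearPerfectMatching_of_deg hd hε0 hε hm hp sdiff_le hmin (fun v => ?_) ht0 hγ hγε ht
    hK hV
  have h1 : (deg G v : ℝ) ≤ deg (G \ H) v + deg H v := by
    exact_mod_cast deg_le_deg_sdiff_add G H v
  linarith [hH v]

end

end Deterministic

section ProcessGraph

variable {N : ℕ}

/-- The first `m` positions of the ordering. -/
def below (N m : ℕ) : Finset (Fin (Fintype.card (EdgeType N))) :=
  Finset.univ.filter fun i => (i : ℕ) < m

lemma card_below {m : ℕ} (hm : m ≤ Fintype.card (EdgeType N)) : (below N m).card = m := by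
  rw [below, Fin.card_filter_val_lt]
  exact min_eq_right hm

lemma card_edgeType (N : ℕ) : (Fintype.card (EdgeType N) : ℝ) = N * (N - 1) / 2 := by
  rw [Sym2.card_subtype_not_diag, Fintype.card_fin, Nat.cast_choose_two]

/-- The edge joining two distinct vertices. -/
def mkEdge {u v : Fin N} (h : u ≠ v) : EdgeType N := ⟨s(u, v), by simpa using h⟩

lemma processGraph_adj {σ : ProcessSpace N} {m : ℕ} {u v : Fin N} :
    (processGraph σ m).Adj u v ↔ ∃ h : u ≠ v, mkEdge h ∈ occupants σ (below N m) := by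
  simp only [processGraph, SimpleGraph.fromEdgeSet_adj, Set.mem_ofPred_eq, mem_occupants, below,
    Finset.mem_filter, Finset.mem_univ, true_and]
  constructor
  · rintro ⟨⟨i, hi, hσ⟩, h⟩
    refine ⟨h, ?_⟩
    have : mkEdge h = σ i := Subtype.ext hσ.symm
    rw [this, Equiv.symm_apply_apply]
    exact hi
  · rintro ⟨h, hlt⟩
    exact ⟨⟨_, hlt, by rw [Equiv.apply_symm_apply]; rfl⟩, h⟩

lemma processGraph_mono (σ : ProcessSpace N) {m m' : ℕ} (h : m ≤ m') :
    processGraph σ m ≤ processGraph σ m' := by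
  intro u v huv
  rw [processGraph_adj] at huv ⊢
  obtain ⟨hne, hmem⟩ := huv
  refine ⟨hne, ?_⟩
  simp only [mem_occupants, below, Finset.mem_filter, Finset.mem_univ, true_and] at hmem ⊢
  omega

/-- The edges spanned by a set of ordered pairs. -/
def edgesOf (P : Finset (Fin N × Fin N)) : Finset (EdgeType N) :=
  Finset.univ.filter fun e => ∃ p ∈ P, s(p.1, p.2) = e.1

lemma card_edgesOf_le (P : Finset (Fin N × Fin N)) : (edgesOf P).card ≤ P.card := by
  rw [← Finset.card_map (Function.Embedding.subtype _)]
  refine (Finset.card_le_card ?_).trans (Finset.card_image_le (f := fun p => s(p.1, p.2)))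
  intro e he
  obtain ⟨e', he', rfl⟩ := Finset.mem_map.1 he
  obtain ⟨p, hp, hpe⟩ := (Finset.mem_filter.1 he').2
  exact Finset.mem_image.2 ⟨p, hp, hpe⟩

open Classical in
lemma map_edgesOf_inter_occupants (σ : ProcessSpace N) (m : ℕ) (P : Finset (Fin N × Fin N)) :
    (edgesOf P ∩ occupants σ (below N m)).map (Function.Embedding.subtype _) =
      (P.filter fun p => (processGraph σ m).Adj p.1 p.2).image fun p => s(p.1, p.2) := by
  ext e
  simp only [Finset.mem_map, Finset.mem_image, Finset.mem_inter, edgesOf, Finset.mem_filter,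
    Finset.mem_univ, true_and, Function.Embedding.subtype_apply, processGraph_adj]
  constructor
  · rintro ⟨e, ⟨⟨p, hp, hpe⟩, he⟩, rfl⟩
    have hne : p.1 ≠ p.2 := by
      have := e.2
      rw [← hpe] at this
      simpa using this
    refine ⟨p, ⟨hp, hne, ?_⟩, hpe⟩
    have : mkEdge hne = e := Subtype.ext hpe
    rwa [this]
  · rintro ⟨p, ⟨hp, hne, hmem⟩, rfl⟩
    exact ⟨mkEdge hne, ⟨⟨p, hp, rfl⟩, hmem⟩, rfl⟩

open Classical in
lemma sum_degIn_eq {V : Type*} [DecidableEq V] (G : SimpleGraph V) (T B : Finset V) :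
    ∑ v ∈ T, degIn G v B = ((T ×ˢ B).filter fun p => G.Adj p.1 p.2).card := by
  rw [Finset.card_eq_sum_card_fiberwise (f := Prod.fst) (t := T)]
  · refine Finset.sum_congr rfl fun v hv => ?_
    unfold degIn
    refine Finset.card_bij (fun w _ => (v, w)) ?_ ?_ ?_
    · intro w hw
      rw [Finset.mem_filter] at hw
      simp [hv, hw.1, hw.2]
    · intro a _ b _ h
      exact (Prod.ext_iff.1 h).2
    · rintro ⟨a, b⟩ h
      simp only [Finset.mem_filter, Finset.mem_product] at h
      obtain ⟨⟨⟨_, h2⟩, h3⟩, rfl⟩ := h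
      exact ⟨b, by simp [h2, h3], rfl⟩
  · intro p hp
    exact (Finset.mem_product.1 (Finset.mem_filter.1 hp).1).1

lemma sum_degIn_self_le (σ : ProcessSpace N) (m : ℕ) (X : Finset (Fin N)) :
    ∑ v ∈ X, degIn (processGraph σ m) v X ≤
      2 * (edgesOf (X ×ˢ X) ∩ occupants σ (below N m)).card := by
  classical
  rw [sum_degIn_eq, ← Finset.card_map (Function.Embedding.subtype _),
    map_edgesOf_inter_occupants]
  refine Finset.card_le_mul_card_image _ 2 fun e he => ?_
  obtain ⟨p, hp, rfl⟩ := Finset.mem_image.1 he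
  refine (Finset.card_le_card (t := {p, p.swap}) ?_).trans Finset.card_le_two
  intro q hq
  have := (Finset.mem_filter.1 hq).2
  rw [Sym2.eq_iff] at this
  simp only [Finset.mem_insert, Finset.mem_singleton, Prod.ext_iff, Prod.fst_swap, Prod.snd_swap]
  exact this

lemma sum_degIn_le_of_disjoint (σ : ProcessSpace N) (m : ℕ) {T B : Finset (Fin N)}
    (h : Disjoint T B) :
    ∑ v ∈ T, degIn (processGraph σ m) v B ≤
      (edgesOf (T ×ˢ B) ∩ occupants σ (below N m)).card := by
  classical
  rw [sum_degIn_eq, ← Finset.card_map (Function.Embedding.subtype _),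
    map_edgesOf_inter_occupants, Finset.card_image_of_injOn]
  intro p hp q hq hpq
  have hp := Finset.mem_product.1 (Finset.mem_filter.1 hp).1
  have hq := Finset.mem_product.1 (Finset.mem_filter.1 hq).1
  rcases Sym2.eq_iff.1 hpq with h1 | h1
  · exact Prod.ext h1.1 h1.2
  · exact absurd (h1.1 ▸ hp.1) (fun h2 => Finset.disjoint_left.1 h h2 hq.2)

/-- The edges at `v`. -/
def star (v : Fin N) : Finset (EdgeType N) := Finset.univ.filter fun e => v ∈ e.1

lemma mem_star {v : Fin N} {e : EdgeType N} : e ∈ star v ↔ v ∈ e.1 := by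
  simp [star]

lemma exists_eq_mkEdge {v : Fin N} {e : EdgeType N} (h : e ∈ star v) :
    ∃ (w : Fin N) (hw : v ≠ w), e = mkEdge hw := by
  obtain ⟨w, hw⟩ := mem_star.1 h
  have hne : v ≠ w := by
    have := e.2
    rw [hw] at this
    simpa using this
  exact ⟨w, hne, Subtype.ext hw⟩

lemma mkEdge_mem_star {v w : Fin N} (h : v ≠ w) : mkEdge h ∈ star v := by
  simp [mem_star, mkEdge]

lemma deg_processGraph (σ : ProcessSpace N) (m : ℕ) (v : Fin N) :
    deg (processGraph σ m) v = (star v ∩ occupants σ (below N m)).card := by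
  classical
  rw [deg_eq_degIn, degIn]
  refine Finset.card_bij (fun w hw =>
    mkEdge (processGraph_adj.1 (Finset.mem_filter.1 hw).2).1) ?_ ?_ ?_
  · intro w hw
    exact Finset.mem_inter.2 ⟨mkEdge_mem_star _,
      (processGraph_adj.1 (Finset.mem_filter.1 hw).2).2⟩
  · intro a _ b _ h
    exact Sym2.congr_right.1 (congrArg Subtype.val h)
  · intro e he
    rw [Finset.mem_inter] at he
    obtain ⟨w, hw, rfl⟩ := exists_eq_mkEdge he.1
    exact ⟨w, Finset.mem_filter.2 ⟨Finset.mem_univ _, processGraph_adj.2 ⟨hw, he.2⟩⟩, rfl⟩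

lemma card_star (v : Fin N) : (star v).card = N - 1 := by
  have : (star v).card = (Finset.univ.erase v).card := by
    symm
    refine Finset.card_bij (fun w hw => mkEdge (Finset.ne_of_mem_erase hw).symm) ?_ ?_ ?_
    · intro w hw
      exact mkEdge_mem_star _
    · intro a _ b _ h
      exact Sym2.congr_right.1 (congrArg Subtype.val h)
    · intro e he
      obtain ⟨w, hw, rfl⟩ := exists_eq_mkEdge he
      exact ⟨w, by simp [hw.symm], rfl⟩
  rw [this, Finset.card_erase_of_mem (Finset.mem_univ v), Finset.card_univ, Fintype.card_fin]

lemma card_star_union_star {u v : Fin N} (h : u ≠ v) :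
    (star u ∪ star v).card = (N - 1) + (N - 2) := by
  have h1 : star u ∩ star v = {mkEdge h} := by
    ext e
    simp only [Finset.mem_inter, Finset.mem_singleton, mem_star]
    rw [Sym2.mem_and_mem_iff h, Subtype.ext_iff]
    rfl
  have h2 := Finset.card_union_add_card_inter (star u) (star v)
  have hN : N ≠ 0 := fun h0 => by subst h0; exact u.elim0
  rw [h1, card_star, card_star, Finset.card_singleton] at h2
  have h3 : 0 < (star u).card := Finset.card_pos.2 ⟨_, mkEdge_mem_star h⟩
  rw [card_star] at h3
  omega

end ProcessGraph

section TailBounds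

variable {N : ℕ}

/-- The edge density of `G_m`. -/
def dens (N m : ℕ) : ℝ := (m : ℝ) / Fintype.card (EdgeType N)

lemma dens_nonneg (N m : ℕ) : 0 ≤ dens N m := by
  unfold dens
  positivity

lemma card_below_div {m : ℕ} (hm : m ≤ Fintype.card (EdgeType N)) :
    ((below N m).card : ℝ) / Fintype.card (EdgeType N) = dens N m := by
  rw [card_below hm, dens]

lemma card_compl_below_div {m : ℕ} (hm : m ≤ Fintype.card (EdgeType N))
    (hN : 0 < Fintype.card (EdgeType N)) :
    (((below N m)ᶜ.card : ℕ) : ℝ) / Fintype.card (EdgeType N) = 1 - dens N m := by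
  rw [Finset.card_compl, card_below hm, Fintype.card_fin, Nat.cast_sub hm, dens]
  field_simp

lemma Pr_sum_degIn_self_lt {m : ℕ} (hm : m ≤ Fintype.card (EdgeType N)) {θ d : ℝ} (hθ : 0 < θ)
    (hd : 0 ≤ d) (hp : dens N m ≤ 2 * d / N) (X : Finset (Fin N))
    (hX : (X.card : ℝ) ≤ Real.exp (-(8 / θ)) / 2 * N) :
    Pr (fun σ : ProcessSpace N => θ * (X.card * d) < ∑ v ∈ X, (degIn (processGraph σ m) v X : ℝ)) ≤
      Real.exp (-3 * d) ^ X.card := by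
  rcases Nat.eq_zero_or_pos N with rfl | hN
  · have : X = ∅ := by
      ext a; exact a.elim0
    subst this
    simpa using (Pr_mono (Q := fun σ : ProcessSpace 0 =>
      ∀ e ∈ (∅ : Finset (EdgeType 0)), σ.symm e ∈ (∅ : Finset _)) (fun σ _ => by simp)).trans (Pr_forall_mem_le _ _)
  have hN' : (0 : ℝ) < N := by exact_mod_cast hN
  have hy : 0 ≤ Real.exp (8 / θ) - 1 := by
    have : 0 ≤ 8 / θ := by positivity
    linarith [Real.one_le_exp this]
  have h := Pr_le_card_inter_occupants (below N m) (edgesOf (X ×ˢ X)) hy (θ * (X.card * d) / 2)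
  rw [card_below_div hm, add_sub_cancel, Real.log_exp] at h
  refine (Pr_mono fun σ hσ => ?_).trans (h.trans ?_)
  · have := sum_degIn_self_le σ m X
    have h2 : (∑ v ∈ X, (degIn (processGraph σ m) v X : ℝ)) ≤
        2 * (edgesOf (X ×ˢ X) ∩ occupants σ (below N m)).card := by exact_mod_cast this
    linarith
  · rw [← Real.exp_nat_mul]
    apply Real.exp_le_exp.2
    have hF : ((edgesOf (X ×ˢ X)).card : ℝ) ≤ X.card * X.card := by
      have := card_edgesOf_le (X ×ˢ X)
      rw [Finset.card_product] at this
      exact_mod_cast this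
    have h1 : (Real.exp (8 / θ) - 1) * dens N m * (edgesOf (X ×ˢ X)).card ≤ X.card * d := by
      calc (Real.exp (8 / θ) - 1) * dens N m * (edgesOf (X ×ˢ X)).card
          ≤ Real.exp (8 / θ) * (2 * d / N) * (X.card * (Real.exp (-(8 / θ)) / 2 * N)) := by
            have := dens_nonneg N m
            gcongr
            · linarith
            · exact hF.trans (by gcongr)
        _ = (Real.exp (8 / θ) * Real.exp (-(8 / θ))) * (X.card * d) := by field_simp
        _ = X.card * d := by rw [← Real.exp_add]; simp
    have h2 : θ * (X.card * d) / 2 * (8 / θ) = 4 * (X.card * d) := by field_simp; ring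
    rw [h2]
    linarith

lemma Pr_exists_sum_degIn_self_lt {m : ℕ} (hm : m ≤ Fintype.card (EdgeType N)) {θ d : ℝ}
    (hθ : 0 < θ) (hd : 0 ≤ d) (hp : dens N m ≤ 2 * d / N) :
    Pr (fun σ : ProcessSpace N => ∃ X : Finset (Fin N),
        (X.card : ℝ) ≤ Real.exp (-(8 / θ)) / 2 * N ∧
        θ * (X.card * d) < ∑ v ∈ X, (degIn (processGraph σ m) v X : ℝ)) ≤
      Real.exp (N * Real.exp (-3 * d)) - 1 := by
  classical
  set s : Finset (Finset (Fin N)) := (Finset.univ.erase ∅).filter fun X =>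
    (X.card : ℝ) ≤ Real.exp (-(8 / θ)) / 2 * N with hs
  calc _ ≤ Pr (fun σ : ProcessSpace N => ∃ X ∈ s,
        θ * (X.card * d) < ∑ v ∈ X, (degIn (processGraph σ m) v X : ℝ)) := by
        refine Pr_mono ?_
        rintro σ ⟨X, h1, h2⟩
        refine ⟨X, ?_, h2⟩
        have : X ≠ ∅ := by
          rintro rfl
          simp at h2
        simp [hs, this, h1]
    _ ≤ ∑ X ∈ s, Real.exp (-3 * d) ^ X.card := by
        refine (Pr_exists_le _ _).trans (Finset.sum_le_sum fun X hX => ?_)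
        exact Pr_sum_degIn_self_lt hm hθ hd hp X (Finset.mem_filter.1 hX).2
    _ ≤ ∑ X ∈ Finset.univ.erase (∅ : Finset (Fin N)), Real.exp (-3 * d) ^ X.card :=
        Finset.sum_le_sum_of_subset_of_nonneg (Finset.filter_subset _ _)
          fun _ _ _ => by positivity
    _ = (Real.exp (-3 * d) + 1) ^ N - 1 := by
        have h1 := Finset.sum_pow_mul_eq_add_pow (Real.exp (-3 * d)) 1 (Finset.univ : Finset (Fin N))
        rw [Finset.powerset_univ] at h1
        simp only [one_pow, mul_one, Finset.card_univ, Fintype.card_fin] at h1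
        rw [← h1, ← Finset.add_sum_erase _ _ (Finset.mem_univ ∅)]
        simp
    _ ≤ _ := by
        rw [Real.exp_nat_mul]
        gcongr
        exact Real.add_one_le_exp _

lemma Pr_sum_degIn_lt_of_disjoint {m t : ℕ} (hm : m ≤ Fintype.card (EdgeType N)) {ε d : ℝ}
    (hε0 : 0 < ε) (hε : ε ≤ 1 / 10) (hN : 0 < N)
    (hd : 0 ≤ d) (hp : dens N m ≤ (1 + ε / 10) * d / N) {T B : Finset (Fin N)} (hTB : Disjoint T B)
    (hT : T.card = t) (hB : (B.card : ℝ) ≤ (1 / 2 + ε / 20) * N) :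
    Pr (fun σ : ProcessSpace N =>
        (1 / 2 + ε / 4) * (t * d) < ∑ v ∈ T, (degIn (processGraph σ m) v B : ℝ)) ≤
      Real.exp (-(ε ^ 2 / 100 * (t * d))) := by
  have hN' : (0 : ℝ) < N := by exact_mod_cast hN
  have h := Pr_le_card_inter_occupants (below N m) (edgesOf (T ×ˢ B)) (y := ε / 5) (by positivity)
    ((1 / 2 + ε / 4) * (t * d))
  rw [card_below_div hm] at h
  refine (Pr_mono fun σ hσ => ?_).trans (h.trans ?_)
  · have h2 : (∑ v ∈ T, (degIn (processGraph σ m) v B : ℝ)) ≤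
        (edgesOf (T ×ˢ B) ∩ occupants σ (below N m)).card := by
      exact_mod_cast sum_degIn_le_of_disjoint σ m hTB
    exact hσ.le.trans h2
  · apply Real.exp_le_exp.2
    have hF : ((edgesOf (T ×ˢ B)).card : ℝ) ≤ t * B.card := by
      have := card_edgesOf_le (T ×ˢ B)
      rw [Finset.card_product, hT] at this
      exact_mod_cast this
    have htd : 0 ≤ (t : ℝ) * d := by positivity
    have h1 : dens N m * (edgesOf (T ×ˢ B)).card ≤ (1 + ε / 10) * (1 / 2 + ε / 20) * (t * d) := by
      calc dens N m * (edgesOf (T ×ˢ B)).card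
          ≤ ((1 + ε / 10) * d / N) * (t * ((1 / 2 + ε / 20) * N)) := by
            have := dens_nonneg N m
            gcongr
            exact hF.trans (by gcongr)
        _ = _ := by field_simp
    have hl := Real.le_log_one_add_of_nonneg (x := ε / 5) (by positivity)
    have hl2 : ε / 5 * (1 - ε / 10) ≤ Real.log (1 + ε / 5) := by
      refine le_trans ?_ hl
      rw [le_div_iff₀ (by positivity)]
      nlinarith [pow_pos hε0 2, pow_pos hε0 3]
    have h3 : (1 / 2 + ε / 4) * (t * d) * (ε / 5 * (1 - ε / 10)) ≤
        (1 / 2 + ε / 4) * (t * d) * Real.log (1 + ε / 5) := by gcongr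
    have h4 : ε / 5 * (dens N m * (edgesOf (T ×ˢ B)).card) ≤
        ε / 5 * ((1 + ε / 10) * (1 / 2 + ε / 20) * (t * d)) := by gcongr
    have h5 : 0 ≤ (t * d) * (ε ^ 2 * (((1 / 2 + ε / 4) * (1 - ε / 10) -
        (1 + ε / 10) * (1 / 2 + ε / 20)) / (5 * ε) - 1 / 100)) := by
      refine mul_nonneg htd (mul_nonneg (by positivity) ?_)
      rw [sub_nonneg, le_div_iff₀ (by positivity)]
      nlinarith [pow_pos hε0 2]
    have h6 : (t * d) * (ε ^ 2 * (((1 / 2 + ε / 4) * (1 - ε / 10) -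
        (1 + ε / 10) * (1 / 2 + ε / 20)) / (5 * ε) - 1 / 100)) =
        (1 / 2 + ε / 4) * (t * d) * (ε / 5 * (1 - ε / 10)) -
        ε / 5 * ((1 + ε / 10) * (1 / 2 + ε / 20) * (t * d)) - ε ^ 2 / 100 * (t * d) := by
      field_simp
    rw [h6] at h5
    linarith

lemma Pr_exists_sum_degIn_lt_of_disjoint {m t : ℕ} (hm : m ≤ Fintype.card (EdgeType N)) {ε d : ℝ}
    (hε0 : 0 < ε) (hε : ε ≤ 1 / 10) (hN : 0 < N)
    (hd : 0 ≤ d) (hp : dens N m ≤ (1 + ε / 10) * d / N) :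
    Pr (fun σ : ProcessSpace N => ∃ T B : Finset (Fin N), Disjoint T B ∧ T.card = t ∧
        (B.card : ℝ) ≤ (1 / 2 + ε / 20) * N ∧
        (1 / 2 + ε / 4) * (t * d) < ∑ v ∈ T, (degIn (processGraph σ m) v B : ℝ)) ≤
      4 ^ N * Real.exp (-(ε ^ 2 / 100 * (t * d))) := by
  classical
  set s : Finset (Finset (Fin N) × Finset (Fin N)) := Finset.univ.filter fun P =>
    Disjoint P.1 P.2 ∧ P.1.card = t ∧ (P.2.card : ℝ) ≤ (1 / 2 + ε / 20) * N with hs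
  calc _ ≤ Pr (fun σ : ProcessSpace N => ∃ P ∈ s,
        (1 / 2 + ε / 4) * (t * d) < ∑ v ∈ P.1, (degIn (processGraph σ m) v P.2 : ℝ)) := by
        refine Pr_mono ?_
        rintro σ ⟨T, B, h1, h2, h3, h4⟩
        exact ⟨(T, B), Finset.mem_filter.2 ⟨Finset.mem_univ _, h1, h2, h3⟩, h4⟩
    _ ≤ ∑ P ∈ s, Real.exp (-(ε ^ 2 / 100 * (t * d))) := by
        refine (Pr_exists_le _ _).trans (Finset.sum_le_sum fun P hP => ?_)
        obtain ⟨-, h1, h2, h3⟩ := Finset.mem_filter.1 hP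
        exact Pr_sum_degIn_lt_of_disjoint hm hε0 hε hN hd hp h1 h2 h3
    _ = s.card * Real.exp (-(ε ^ 2 / 100 * (t * d))) := by rw [Finset.sum_const, nsmul_eq_mul]
    _ ≤ _ := by
        gcongr
        have := Finset.card_le_univ s
        rw [Fintype.card_prod, Fintype.card_finset, Fintype.card_fin, ← mul_pow] at this
        exact_mod_cast this

lemma Pr_deg_lt {m : ℕ} (hm : m ≤ Fintype.card (EdgeType N)) {ε d : ℝ}
    (hε0 : 0 < ε) (hε : ε ≤ 1 / 10) (hN : 1 < N)
    (hd : 0 ≤ d) (hp : (1 - 3 * ε / 20) * d ≤ dens N m * (N - 1)) (v : Fin N) :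
    Pr (fun σ : ProcessSpace N => (deg (processGraph σ m) v : ℝ) < (1 - ε / 5) * d) ≤
      Real.exp (-(ε ^ 2 / 2000 * d)) := by
  have hN' : (1 : ℝ) < N := by exact_mod_cast hN
  have hE : 0 < Fintype.card (EdgeType N) := by
    have := card_edgeType N
    have h2 : (0 : ℝ) < N * (N - 1) / 2 := by
      have : (0 : ℝ) < N - 1 := by linarith
      positivity
    rw [← this] at h2
    exact_mod_cast h2
  have h := Pr_card_inter_occupants_le (fun _ : ProcessSpace N => True) (below N m) hE (star v)
    (c := 1) (y := ε / 50) zero_le_one (by positivity)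
    (fun R _ => by simpa using Pr_forall_mem_le (below N m)ᶜ R) ((1 - ε / 5) * d)
  rw [card_below_div hm, one_mul, card_star] at h
  refine (Pr_mono fun σ hσ => ?_).trans (h.trans ?_)
  · rw [deg_processGraph] at hσ
    exact ⟨trivial, hσ.le⟩
  · apply Real.exp_le_exp.2
    have h1 : Real.log (1 + ε / 50) ≤ ε / 50 := by
      have := Real.log_le_sub_one_of_pos (show 0 < 1 + ε / 50 by positivity)
      linarith
    have h2 : (1 - ε / 5) * d * Real.log (1 + ε / 50) ≤ (1 - ε / 5) * d * (ε / 50) := by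
      have : 0 ≤ 1 - ε / 5 := by linarith
      gcongr
    have h3 : ε / 50 * (1 - ε / 50) ≤ ε / 50 / (1 + ε / 50) := by
      rw [le_div_iff₀ (by positivity)]
      nlinarith [pow_pos hε0 2, pow_pos hε0 3]
    have h4 : ε / 50 * (1 - ε / 50) * ((1 - 3 * ε / 20) * d) ≤
        ε / 50 / (1 + ε / 50) * (dens N m * (N - 1)) := by
      have h5 : 0 ≤ 1 - ε / 50 := by linarith
      have h6 : 0 ≤ 1 - 3 * ε / 20 := by linarith
      gcongr
    rw [Nat.cast_sub hN.le, Nat.cast_one, mul_assoc (ε / 50 / (1 + ε / 50))]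
    have h7 : 0 ≤ d * ε ^ 2 * (1 / 50 * (1 / 5 - 1 / 50 - 3 / 20 + 3 * ε / 1000) - 1 / 2000) :=
      mul_nonneg (by positivity) (by linarith)
    nlinarith

lemma Pr_many_deg_lt {m : ℕ} (hm : m ≤ Fintype.card (EdgeType N)) {ε γ d : ℝ}
    (hε0 : 0 < ε) (hε : ε ≤ 1 / 10) (hγ : 0 < γ) (hN : 1 < N)
    (hd : 0 ≤ d) (hp : (1 - 3 * ε / 20) * d ≤ dens N m * (N - 1)) :
    Pr (fun σ : ProcessSpace N => γ / 8 * N <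
        ((Finset.univ.filter fun v => (deg (processGraph σ m) v : ℝ) < (1 - ε / 5) * d).card : ℝ)) ≤
      8 / γ * Real.exp (-(ε ^ 2 / 2000 * d)) := by
  classical
  have hN' : (0 : ℝ) < N := by exact_mod_cast (zero_lt_one.trans hN)
  calc _ ≤ Ex (fun σ : ProcessSpace N => 8 / (γ * N) * ∑ v : Fin N,
        if (deg (processGraph σ m) v : ℝ) < (1 - ε / 5) * d then (1 : ℝ) else 0) := by
        refine Pr_le_Ex (fun σ => ?_) fun σ hσ => ?_
        · refine mul_nonneg (by positivity) (Finset.sum_nonneg fun v _ => by positivity)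
        · rw [Finset.sum_boole, div_mul_eq_mul_div, le_div_iff₀ (by positivity)]
          linarith
    _ = 8 / (γ * N) * ∑ v : Fin N,
          Pr (fun σ : ProcessSpace N => (deg (processGraph σ m) v : ℝ) < (1 - ε / 5) * d) := by
        rw [Ex_const_mul, Ex_sum]
        rfl
    _ ≤ 8 / (γ * N) * ∑ v : Fin N, Real.exp (-(ε ^ 2 / 2000 * d)) := by
        gcongr with v
        exact Pr_deg_lt hm hε0 hε hN hd hp v
    _ = _ := by
        rw [Finset.sum_const, Finset.card_univ, Fintype.card_fin, nsmul_eq_mul]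
        field_simp

end TailBounds

section TinyVertices

variable {N : ℕ}

lemma Pr_subset_and_deg_lt {m m' : ℕ} (hm : m ≤ Fintype.card (EdgeType N))
    (hm' : m' ≤ Fintype.card (EdgeType N)) {d : ℝ} (hd : 0 ≤ d) (hN : 1000 ≤ N)
    (hp : 99 / 100 * d / N ≤ dens N m) (hp' : dens N m' ≤ 2 * d / N) {u v : Fin N} (huv : u ≠ v)
    (R : Finset (EdgeType N)) (hR : R.card ≤ 4) :
    Pr (fun σ : ProcessSpace N => R ⊆ occupants σ (below N m') ∧
        (deg (processGraph σ m) u : ℝ) < d / 100 ∧ (deg (processGraph σ m) v : ℝ) < d / 100) ≤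
      (4 * d / N) ^ R.card * Real.exp (-(8 / 5 * d)) := by
  classical
  have hN' : (1000 : ℝ) ≤ N := by exact_mod_cast hN
  have hN0 : (0 : ℝ) < N := by linarith
  have hM : (Fintype.card (EdgeType N) : ℝ) = N * (N - 1) / 2 := card_edgeType N
  have hMN : 100 * (N : ℝ) ≤ Fintype.card (EdgeType N) := by rw [hM]; nlinarith
  have hE : 0 < Fintype.card (EdgeType N) := by
    have h2 : (0 : ℝ) < Fintype.card (EdgeType N) := by linarith
    exact_mod_cast h2
  set F : Finset (EdgeType N) := (star u ∪ star v) \ R with hF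
  have hFle : (F.card : ℝ) ≤ 2 * N := by
    have h1 : F.card ≤ (star u ∪ star v).card := Finset.card_le_card Finset.sdiff_subset
    rw [card_star_union_star huv] at h1
    have : F.card ≤ 2 * N := by omega
    exact_mod_cast this
  have hFge : 2 * (N : ℝ) - 7 ≤ F.card := by
    have h1 : (star u ∪ star v).card - R.card ≤ F.card := Finset.le_card_sdiff _ _
    rw [card_star_union_star huv] at h1
    have : 2 * N ≤ F.card + 7 := by omega
    have : (2 * N : ℝ) ≤ F.card + 7 := by exact_mod_cast this
    linarith
  have hR' : (R.card : ℝ) ≤ 4 := by exact_mod_cast hR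
  have h := Pr_card_inter_occupants_le (fun σ : ProcessSpace N => ∀ e ∈ R, σ.symm e ∈ below N m')
    (below N m) hE F (c := (2 * dens N m') ^ R.card) (y := 9)
    (by have := dens_nonneg N m'; positivity) (by norm_num)
    (by
      intro T hT
      have hTle : (T.card : ℝ) ≤ F.card := by exact_mod_cast Finset.card_le_card hT
      have := Pr_forall_mem_and_le (below N m)ᶜ (below N m') T R
        (Finset.disjoint_of_subset_left hT Finset.sdiff_disjoint)
        (D := Fintype.card (EdgeType N) / 2) (by positivity) (by linarith)
      have h2 : ((below N m').card : ℝ) / (Fintype.card (EdgeType N) / 2) = 2 * dens N m' := by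
        rw [← card_below_div hm']
        field_simp
      rwa [h2] at this) (d / 50)
  rw [card_below_div hm] at h
  refine (Pr_mono ?_).trans (h.trans ?_)
  · rintro σ ⟨h1, h2, h3⟩
    refine ⟨fun e he => mem_occupants.1 (h1 he), ?_⟩
    rw [deg_processGraph] at h2 h3
    have h4 : (F ∩ occupants σ (below N m)).card ≤
        (star u ∩ occupants σ (below N m)).card + (star v ∩ occupants σ (below N m)).card := by
      refine (Finset.card_le_card ?_).trans (Finset.card_union_le _ _)
      intro e he
      simp only [hF, Finset.mem_inter, Finset.mem_sdiff, Finset.mem_union] at he ⊢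
      tauto
    have h4 : ((F ∩ occupants σ (below N m)).card : ℝ) ≤
        (star u ∩ occupants σ (below N m)).card + (star v ∩ occupants σ (below N m)).card := by
      exact_mod_cast h4
    linarith
  · have h0 := dens_nonneg N m'
    have hlog : Real.log (1 + 9) ≤ 3 := by
      rw [Real.log_le_iff_le_exp (by norm_num)]
      have h1 := Real.exp_one_gt_d9
      have h2 : Real.exp 3 = Real.exp 1 ^ 3 := by rw [← Real.exp_nat_mul]; norm_num
      rw [h2]
      calc (1 + 9 : ℝ) ≤ 2.7 ^ 3 := by norm_num
        _ ≤ _ := by gcongr; linarith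
    have hpF : 193 / 100 * d ≤ dens N m * F.card := by
      calc 193 / 100 * d ≤ 99 / 100 * d / N * (2 * N - 7) := by
            have : 99 / 100 * d / N * (2 * N - 7) = 99 / 100 * d * (2 - 7 / N) := by field_simp
            rw [this]
            have : 7 / (N : ℝ) ≤ 7 / 1000 := by gcongr
            nlinarith
        _ ≤ _ := by
            have : (0 : ℝ) ≤ 2 * N - 7 := by linarith
            have h5 := dens_nonneg N m
            gcongr
    gcongr
    · calc 2 * dens N m' ≤ 2 * (2 * d / N) := by gcongr
        _ = 4 * d / N := by ring
    · rw [mul_assoc]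
      have : d / 50 * Real.log (1 + 9) ≤ d / 50 * 3 := by gcongr
      norm_num at this ⊢
      linarith

lemma Pr_exists_subset_and_deg_lt {m m' : ℕ} (hm : m ≤ Fintype.card (EdgeType N))
    (hm' : m' ≤ Fintype.card (EdgeType N)) {d : ℝ} (hd : 1 ≤ d) (hN : 1000 ≤ N)
    (hp : 99 / 100 * d / N ≤ dens N m) (hp' : dens N m' ≤ 2 * d / N) {ι : Type*} [Fintype ι]
    (r : ℕ) (hr : r ≤ 3) (hι : Fintype.card ι = N ^ (r + 2))
    (P : ι → Prop) (x y : ι → Fin N) (R : ι → Finset (EdgeType N))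
    (hP : ∀ i, P i → x i ≠ y i ∧ (R i).card = r + 1) :
    Pr (fun σ : ProcessSpace N => ∃ i, P i ∧ R i ⊆ occupants σ (below N m') ∧
        (deg (processGraph σ m) (x i) : ℝ) < d / 100 ∧
        (deg (processGraph σ m) (y i) : ℝ) < d / 100) ≤
      N * ((4 * d) ^ 4 * Real.exp (-(8 / 5 * d))) := by
  classical
  have hN0 : (0 : ℝ) < N := by
    have : 0 < N := by omega
    exact_mod_cast this
  calc _ ≤ Pr (fun σ : ProcessSpace N => ∃ i ∈ Finset.univ.filter P,
        R i ⊆ occupants σ (below N m') ∧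
        (deg (processGraph σ m) (x i) : ℝ) < d / 100 ∧
        (deg (processGraph σ m) (y i) : ℝ) < d / 100) := by
        refine Pr_mono ?_
        rintro σ ⟨i, h1, h2⟩
        exact ⟨i, by simpa using h1, h2⟩
    _ ≤ ∑ i ∈ Finset.univ.filter P, (4 * d / N) ^ (r + 1) * Real.exp (-(8 / 5 * d)) := by
        refine (Pr_exists_le _ _).trans (Finset.sum_le_sum fun i hi => ?_)
        obtain ⟨h1, h2⟩ := hP i (Finset.mem_filter.1 hi).2
        rw [← h2]
        exact Pr_subset_and_deg_lt hm hm' (by linarith) hN hp hp' h1 _ (by omega)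
    _ ≤ (N : ℝ) ^ (r + 2) * ((4 * d / N) ^ (r + 1) * Real.exp (-(8 / 5 * d))) := by
        rw [Finset.sum_const, nsmul_eq_mul]
        gcongr
        have := Finset.card_le_univ (Finset.univ.filter P)
        rw [hι] at this
        exact_mod_cast this
    _ = N * ((4 * d) ^ (r + 1) * Real.exp (-(8 / 5 * d))) := by
        rw [div_pow, pow_succ (N : ℝ) (r + 1)]
        field_simp
    _ ≤ _ := by
        gcongr
        · linarith
        · omega

lemma Pr_exists_tiny_adj {m m' : ℕ} (hm : m ≤ Fintype.card (EdgeType N))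
    (hm' : m' ≤ Fintype.card (EdgeType N)) {d : ℝ} (hd : 1 ≤ d) (hN : 1000 ≤ N)
    (hp : 99 / 100 * d / N ≤ dens N m) (hp' : dens N m' ≤ 2 * d / N) :
    Pr (fun σ : ProcessSpace N => ∃ u v, (deg (processGraph σ m) u : ℝ) < d / 100 ∧
        (deg (processGraph σ m) v : ℝ) < d / 100 ∧ (processGraph σ m').Adj u v) ≤
      N * ((4 * d) ^ 4 * Real.exp (-(8 / 5 * d))) := by
  classical
  refine (Pr_mono ?_).trans (Pr_exists_subset_and_deg_lt hm hm' hd hN hp hp' (ι := Fin N × Fin N)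
    0 (by norm_num) (by simp [pow_two]) (fun i => i.1 ≠ i.2) (fun i => i.1) (fun i => i.2)
    (fun i => if h : i.1 ≠ i.2 then {mkEdge h} else ∅) ?_)
  · rintro σ ⟨u, v, h1, h2, h3⟩
    obtain ⟨hne, hmem⟩ := processGraph_adj.1 h3
    exact ⟨(u, v), hne, by simp [hne, hmem], h1, h2⟩
  · intro i hi
    exact ⟨hi, by simp [hi]⟩

lemma Pr_exists_tiny_common {m m' : ℕ} (hm : m ≤ Fintype.card (EdgeType N))
    (hm' : m' ≤ Fintype.card (EdgeType N)) {d : ℝ} (hd : 1 ≤ d) (hN : 1000 ≤ N)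
    (hp : 99 / 100 * d / N ≤ dens N m) (hp' : dens N m' ≤ 2 * d / N) :
    Pr (fun σ : ProcessSpace N => ∃ u v w, u ≠ v ∧ (deg (processGraph σ m) u : ℝ) < d / 100 ∧
        (deg (processGraph σ m) v : ℝ) < d / 100 ∧ (processGraph σ m').Adj u w ∧
        (processGraph σ m').Adj v w) ≤
      N * ((4 * d) ^ 4 * Real.exp (-(8 / 5 * d))) := by
  classical
  refine (Pr_mono ?_).trans (Pr_exists_subset_and_deg_lt hm hm' hd hN hp hp'
    (ι := Fin N × Fin N × Fin N)
    1 (by norm_num) (by simp; ring) (fun i => i.1 ≠ i.2.1 ∧ i.1 ≠ i.2.2 ∧ i.2.1 ≠ i.2.2)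
    (fun i => i.1) (fun i => i.2.1)
    (fun i => if h : i.1 ≠ i.2.2 ∧ i.2.1 ≠ i.2.2 then {mkEdge h.1, mkEdge h.2} else ∅) ?_)
  · rintro σ ⟨u, v, w, huv, h1, h2, h3, h4⟩
    obtain ⟨hne, hmem⟩ := processGraph_adj.1 h3
    obtain ⟨hne', hmem'⟩ := processGraph_adj.1 h4
    exact ⟨(u, v, w), ⟨huv, hne, hne'⟩,
      by simp [hne, hne', Finset.insert_subset_iff, hmem, hmem'], h1, h2⟩
  · rintro ⟨u, v, w⟩ ⟨h1, h2, h3⟩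
    refine ⟨h1, ?_⟩
    rw [dif_pos ⟨h2, h3⟩, Finset.card_pair]
    intro h
    exact h1 (Sym2.congr_left.1 (congrArg Subtype.val h))

lemma Pr_exists_tiny_path {m m' : ℕ} (hm : m ≤ Fintype.card (EdgeType N))
    (hm' : m' ≤ Fintype.card (EdgeType N)) {d : ℝ} (hd : 1 ≤ d) (hN : 1000 ≤ N)
    (hp : 99 / 100 * d / N ≤ dens N m) (hp' : dens N m' ≤ 2 * d / N) :
    Pr (fun σ : ProcessSpace N => ∃ u v x w y, [u, v, x, w, y].Nodup ∧
        (deg (processGraph σ m) u : ℝ) < d / 100 ∧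
        (deg (processGraph σ m) v : ℝ) < d / 100 ∧ (processGraph σ m').Adj u x ∧
        (processGraph σ m').Adj x w ∧ (processGraph σ m').Adj y w ∧
        (processGraph σ m').Adj v y) ≤
      N * ((4 * d) ^ 4 * Real.exp (-(8 / 5 * d))) := by
  classical
  refine (Pr_mono ?_).trans (Pr_exists_subset_and_deg_lt hm hm' hd hN hp hp'
    (ι := Fin N × Fin N × Fin N × Fin N × Fin N)
    3 (by norm_num) (by simp; ring)
    (fun i => [i.1, i.2.1, i.2.2.1, i.2.2.2.1, i.2.2.2.2].Nodup)
    (fun i => i.1) (fun i => i.2.1)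
    (fun i => if h : i.1 ≠ i.2.2.1 ∧ i.2.2.1 ≠ i.2.2.2.1 ∧ i.2.2.2.2 ≠ i.2.2.2.1 ∧
        i.2.1 ≠ i.2.2.2.2 then {mkEdge h.1, mkEdge h.2.1, mkEdge h.2.2.1, mkEdge h.2.2.2} else ∅)
    ?_)
  · rintro σ ⟨u, v, x, w, y, hnd, h1, h2, h3, h4, h5, h6⟩
    obtain ⟨hne3, hmem3⟩ := processGraph_adj.1 h3
    obtain ⟨hne4, hmem4⟩ := processGraph_adj.1 h4
    obtain ⟨hne5, hmem5⟩ := processGraph_adj.1 h5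
    obtain ⟨hne6, hmem6⟩ := processGraph_adj.1 h6
    exact ⟨(u, v, x, w, y), hnd,
      by simp [hne3, hne4, hne5, hne6, Finset.insert_subset_iff, hmem3, hmem4, hmem5, hmem6],
      h1, h2⟩
  · rintro ⟨u, v, x, w, y⟩ hnd
    simp only [List.nodup_cons, List.mem_cons, List.not_mem_nil, or_false, not_or] at hnd
    obtain ⟨⟨huv, hux, huw, huy⟩, ⟨hvx, hvw, hvy⟩, ⟨hxw, hxy⟩, hwy, -⟩ := hnd
    refine ⟨huv, ?_⟩
    rw [dif_pos ⟨hux, hxw, Ne.symm hwy, hvy⟩]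
    simp only [mkEdge]
    rw [Finset.card_insert_of_notMem, Finset.card_insert_of_notMem, Finset.card_pair]
    all_goals
      simp only [Finset.mem_insert, Finset.mem_singleton, ne_eq, Subtype.mk.injEq, Sym2.eq_iff]
      grind

end TinyVertices

section Isolated

variable {N : ℕ}

lemma deg_processGraph_eq_zero_iff {σ : ProcessSpace N} {m : ℕ} {v : Fin N} :
    deg (processGraph σ m) v = 0 ↔ ∀ e ∈ star v, σ.symm e ∈ (below N m)ᶜ := by
  rw [deg_processGraph, Finset.card_eq_zero, ← Finset.disjoint_iff_inter_eq_empty,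
    Finset.disjoint_left]
  simp only [mem_occupants, Finset.mem_compl]

lemma Pr_exists_deg_eq_zero {m : ℕ} (hm : m ≤ Fintype.card (EdgeType N)) (hN : 1 < N) :
    Pr (fun σ : ProcessSpace N => ∃ v, deg (processGraph σ m) v = 0) ≤
      N * Real.exp (-(dens N m * (N - 1))) := by
  classical
  have hE : 0 < Fintype.card (EdgeType N) := by
    have := card_edgeType N
    have h2 : (0 : ℝ) < N * (N - 1) / 2 := by
      have : (1 : ℝ) < N := by exact_mod_cast hN
      have : (0 : ℝ) < N - 1 := by linarith
      positivity
    rw [← this] at h2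
    exact_mod_cast h2
  calc _ ≤ Pr (fun σ : ProcessSpace N => ∃ v ∈ Finset.univ,
        ∀ e ∈ star v, σ.symm e ∈ (below N m)ᶜ) := by
        refine Pr_mono ?_
        rintro σ ⟨v, h⟩
        exact ⟨v, Finset.mem_univ v, deg_processGraph_eq_zero_iff.1 h⟩
    _ ≤ ∑ v : Fin N, Real.exp (-dens N m) ^ (N - 1) := by
        refine (Pr_exists_le _ _).trans (Finset.sum_le_sum fun v _ => ?_)
        refine (Pr_forall_mem_le _ _).trans ?_
        rw [card_compl_below_div hm hE, card_star]
        have h0 : 0 ≤ 1 - dens N m := by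
          rw [← card_compl_below_div hm hE]
          positivity
        gcongr
        linarith [Real.add_one_le_exp (-dens N m)]
    _ = _ := by
        rw [Finset.sum_const, Finset.card_univ, Fintype.card_fin, nsmul_eq_mul,
          ← Real.exp_nat_mul, Nat.cast_sub hN.le, Nat.cast_one]
        congr 2
        ring

end Isolated

section SecondMoment

variable {N : ℕ}

/-- Chebyshev's inequality for the number of events that occur. -/
lemma Pr_forall_not_le {Ω ι : Type*} [Fintype Ω] [Nonempty Ω] [Fintype ι] [Nonempty ι]
    (A : ι → Ω → Prop) {a b : ℝ} (ha : 0 < a) (hb : 0 ≤ b) (h1 : ∀ i, Pr (A i) = a)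
    (h2 : ∀ i j, i ≠ j → Pr (fun ω => A i ω ∧ A j ω) ≤ b) :
    Pr (fun ω => ∀ i, ¬ A i ω) ≤ 1 / (Fintype.card ι * a) + (b / a ^ 2 - 1) := by
  classical
  set k : ℝ := (Fintype.card ι : ℝ) with hk
  have hk0 : 0 < k := by
    rw [hk]
    exact_mod_cast Fintype.card_pos
  set X : Ω → ℝ := fun ω => ∑ i, if A i ω then (1 : ℝ) else 0 with hX
  have hEX : Ex X = k * a := by
    rw [hX, Ex_sum]
    simp_rw [← Pr_eq_Ex, h1]
    simp [hk]
  have hEX2 : Ex (fun ω => X ω * X ω) ≤ k * a + k ^ 2 * b := by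
    have h3 : (fun ω => X ω * X ω) = fun ω => ∑ i, ∑ j, if A i ω ∧ A j ω then (1 : ℝ) else 0 := by
      funext ω
      simp only [hX, Finset.sum_mul_sum]
      refine Finset.sum_congr rfl fun i _ => Finset.sum_congr rfl fun j _ => ?_
      by_cases hi : A i ω <;> by_cases hj : A j ω <;> simp [hi, hj]
    rw [h3, Ex_sum]
    simp_rw [Ex_sum, ← Pr_eq_Ex]
    calc _ ≤ ∑ i : ι, ∑ j : ι, ((if i = j then a else 0) + b) := by
          refine Finset.sum_le_sum fun i _ => Finset.sum_le_sum fun j _ => ?_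
          by_cases hij : i = j
          · subst hij
            simp only [and_self, h1, if_true]
            linarith
          · simpa [hij] using h2 i j hij
      _ = k * a + k ^ 2 * b := by
          simp only [Finset.sum_add_distrib, Finset.sum_ite_eq, Finset.mem_univ, if_true,
            Finset.sum_const, Finset.card_univ, nsmul_eq_mul, ← hk]
          ring
  calc Pr (fun ω => ∀ i, ¬ A i ω)
      ≤ Ex (fun ω => (k * a)⁻¹ ^ 2 * (X ω * X ω) + (-2 * (k * a)⁻¹ * X ω + 1 * 1)) := by
        refine Pr_le_Ex (fun ω => ?_) fun ω hω => ?_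
        · nlinarith [sq_nonneg ((k * a)⁻¹ * X ω - 1)]
        · have : X ω = 0 := by simp [hX, hω]
          simp [this]
    _ = (k * a)⁻¹ ^ 2 * Ex (fun ω => X ω * X ω) + (-2 * (k * a)⁻¹ * Ex X + 1) := by
        rw [Ex_add, Ex_add, Ex_const_mul, Ex_const_mul, Ex_const_mul, Ex_one, mul_one]
    _ ≤ (k * a)⁻¹ ^ 2 * (k * a + k ^ 2 * b) + (-2 * (k * a)⁻¹ * (k * a) + 1) := by
        rw [hEX]
        gcongr
    _ = _ := by
        field_simp
        ring

lemma Pr_forall_deg_ne_zero_le {m : ℕ} (hm : m ≤ Fintype.card (EdgeType N)) (hN : 3 ≤ N)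
    (hmN : (m : ℝ) + 2 * N ≤ Fintype.card (EdgeType N)) :
    Pr (fun σ : ProcessSpace N => ∀ v, deg (processGraph σ m) v ≠ 0) ≤
      Real.exp (N * (m / (Fintype.card (EdgeType N) - m - N))) / N +
        m / (Fintype.card (EdgeType N) - m - N) := by
  classical
  have hN' : (3 : ℝ) ≤ N := by exact_mod_cast hN
  set M : ℝ := (Fintype.card (EdgeType N) : ℝ) with hM
  set s : ℝ := m / (M - m - N) with hs
  have hm0 : (0 : ℝ) ≤ m := by positivity
  have hs0 : 0 ≤ s := div_nonneg hm0 (by linarith)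
  set q : ℕ → ℝ := fun i => (M - m - i) / (M - i) with hq
  have hcard : (((below N m)ᶜ.card : ℕ) : ℝ) = M - m := by
    rw [Finset.card_compl, card_below hm, Fintype.card_fin, Nat.cast_sub hm]
  have hprod : ∀ T : Finset (EdgeType N),
      Pr (fun σ : ProcessSpace N => ∀ e ∈ T, σ.symm e ∈ (below N m)ᶜ) =
        ∏ i ∈ Finset.range T.card, q i := by
    intro T
    rw [Pr_forall_mem, hcard]
  have hqpos : ∀ i : ℕ, i < 2 * N → 0 < q i := by
    intro i hi
    have : (i : ℝ) < 2 * N := by exact_mod_cast hi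
    exact div_pos (by linarith) (by linarith)
  have hqle : ∀ i : ℕ, i < 2 * N → ∀ j ≤ i, q i ≤ q j := by
    intro i hi j hj
    have h1 : (i : ℝ) < 2 * N := by exact_mod_cast hi
    have h2 : (j : ℝ) ≤ i := by exact_mod_cast hj
    simp only [hq]
    rw [div_le_div_iff₀ (by linarith) (by linarith)]
    nlinarith
  have hqge : ∀ i ≤ N, 1 / (1 + s) ≤ q i := by
    intro i hi
    have h1 : (i : ℝ) ≤ N := by exact_mod_cast hi
    have h2 : s * (M - m - N) = m := by
      rw [hs]
      have : M - m - N ≠ 0 := by linarith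
      field_simp
    simp only [hq]
    rw [div_le_div_iff₀ (by linarith) (by linarith)]
    nlinarith
  set a : ℝ := ∏ i ∈ Finset.range (N - 1), q i with ha
  set b : ℝ := ∏ i ∈ Finset.range ((N - 1) + (N - 2)), q i with hb
  have ha0 : 0 < a := Finset.prod_pos fun i hi => hqpos i (by
    have := Finset.mem_range.1 hi; omega)
  have hb0 : 0 ≤ b := Finset.prod_nonneg fun i hi => (hqpos i (by
    have := Finset.mem_range.1 hi; omega)).le
  have hexp : 1 + s ≤ Real.exp s := by linarith [Real.add_one_le_exp s]
  have haexp : Real.exp (-(N * s)) ≤ a := by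
    calc Real.exp (-(N * s)) = Real.exp (-s) ^ N := by
          rw [← Real.exp_nat_mul]
          congr 1; ring
      _ ≤ Real.exp (-s) ^ (N - 1) := by
          refine pow_le_pow_of_le_one (by positivity) ?_ (by omega)
          rw [Real.exp_le_one_iff]
          linarith
      _ ≤ (1 / (1 + s)) ^ (N - 1) := by
          gcongr
          rw [Real.exp_neg, ← one_div]
          gcongr
      _ = ∏ i ∈ Finset.range (N - 1), (1 / (1 + s)) := by simp
      _ ≤ a := Finset.prod_le_prod (fun i _ => by positivity) fun i hi => hqge i (by
          have := Finset.mem_range.1 hi; omega)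
  have hba : b ≤ a ^ 2 * (1 + s) := by
    have h1 : ∏ i ∈ Finset.range (N - 2), q (N - 1 + i) ≤ ∏ i ∈ Finset.range (N - 2), q i :=
      Finset.prod_le_prod (fun i hi => (hqpos _ (by have := Finset.mem_range.1 hi; omega)).le)
        fun i hi => hqle _ (by have := Finset.mem_range.1 hi; omega) _ (by omega)
    have h2 : a = (∏ i ∈ Finset.range (N - 2), q i) * q (N - 2) := by
      rw [ha, ← Finset.prod_range_succ]
      congr 2
      omega
    have h3 := hqge (N - 2) (by omega)
    rw [div_le_iff₀ (by linarith)] at h3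
    have h4 : 0 ≤ ∏ i ∈ Finset.range (N - 2), q i :=
      Finset.prod_nonneg fun i hi => (hqpos _ (by have := Finset.mem_range.1 hi; omega)).le
    calc b = a * ∏ i ∈ Finset.range (N - 2), q (N - 1 + i) := by
          rw [hb, Finset.prod_range_add]
      _ ≤ a * (∏ i ∈ Finset.range (N - 2), q i) := by gcongr
      _ = a * (∏ i ∈ Finset.range (N - 2), q i) * 1 := by ring
      _ ≤ a * (∏ i ∈ Finset.range (N - 2), q i) * (q (N - 2) * (1 + s)) := by gcongr
      _ = a ^ 2 * (1 + s) := by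
          linear_combination -(a * (1 + s)) * h2
  have : Nonempty (Fin N) := ⟨⟨0, by omega⟩⟩
  have : Nonempty (ProcessSpace N) := ⟨(Fintype.equivFin _).symm⟩
  have h := Pr_forall_not_le
    (fun (v : Fin N) (σ : ProcessSpace N) => ∀ e ∈ star v, σ.symm e ∈ (below N m)ᶜ) ha0 hb0
    (fun v => by rw [hprod, card_star]) (fun u v huv => by
      have h1 : (fun σ : ProcessSpace N => (∀ e ∈ star u, σ.symm e ∈ (below N m)ᶜ) ∧
          ∀ e ∈ star v, σ.symm e ∈ (below N m)ᶜ) =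
          fun σ => ∀ e ∈ star u ∪ star v, σ.symm e ∈ (below N m)ᶜ := by
        funext σ
        rw [Finset.forall_mem_union]
      rw [h1, hprod, card_star_union_star huv])
  refine (Pr_mono fun σ hσ v hv => hσ v (deg_processGraph_eq_zero_iff.2 hv)).trans (h.trans ?_)
  rw [Fintype.card_fin]
  refine add_le_add ?_ ?_
  · calc 1 / (N * a) ≤ 1 / (N * Real.exp (-(N * s))) := by gcongr
      _ = Real.exp (N * s) / N := by
        rw [Real.exp_neg]
        field_simp
  · rw [sub_le_iff_le_add, div_le_iff₀ (by positivity)]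
    linarith

end SecondMoment

section Asymptotics

lemma tendsto_log_natCast : Tendsto (fun N : ℕ => Real.log N) atTop atTop :=
  Real.tendsto_log_atTop.comp tendsto_natCast_atTop_atTop

lemma eventually_log_natCast_le {c : ℝ} (hc : 0 < c) :
    ∀ᶠ N : ℕ in atTop, Real.log N ≤ c * N := by
  have h := (Real.isLittleO_log_id_atTop.bound hc).and (eventually_ge_atTop 0)
  filter_upwards [tendsto_natCast_atTop_atTop.eventually h] with N hN
  have := (Real.le_norm_self _).trans hN.1
  rwa [id, Real.norm_of_nonneg hN.2] at this

/-- There are steps `m ≤ m'` sandwiching the hitting time, at which the average degrees are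
slightly below and slightly above `log N`. -/
lemma eventually_exists_steps {ε : ℝ} (hε0 : 0 < ε) (hε : ε ≤ 1 / 10) :
    ∀ᶠ N : ℕ in atTop, ∃ m m' : ℕ, m ≤ m' ∧ m' ≤ Fintype.card (EdgeType N) ∧
      (1 - 3 * ε / 20) * Real.log N ≤ dens N m * (N - 1) ∧
      99 / 100 * Real.log N / N ≤ dens N m ∧
      dens N m' ≤ (1 + ε / 10) * Real.log N / N ∧
      (1 + ε / 40) * Real.log N ≤ dens N m' * (N - 1) ∧
      (m : ℝ) + 2 * N ≤ Fintype.card (EdgeType N) ∧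
      N * (m / (Fintype.card (EdgeType N) - m - N)) ≤ (1 - ε / 40) * Real.log N := by
  filter_upwards [tendsto_log_natCast.eventually_ge_atTop (max 2 (20 / ε)),
    eventually_log_natCast_le (c := ε / 160) (by positivity),
    tendsto_natCast_atTop_atTop.eventually_ge_atTop (max 1000 (800 / ε))] with N hd hdN hN
  set d := Real.log N with hdef
  set η := ε / 20 with hη
  have hη0 : 0 < η := by positivity
  have hη1 : η ≤ 1 / 200 := by rw [hη]; linarith
  have hd2 : 2 ≤ d := (le_max_left _ _).trans hd
  have hηd : 1 ≤ η * d := by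
    have := (le_max_right _ _).trans hd
    rw [div_le_iff₀ hε0] at this
    rw [hη]; linarith
  have hN1 : (1000 : ℝ) ≤ N := (le_max_left _ _).trans hN
  have hηN : 40 ≤ η * N := by
    have := (le_max_right _ _).trans hN
    rw [div_le_iff₀ hε0] at this
    rw [hη]; linarith
  have hdN : d ≤ η / 8 * N := by rw [hη]; linarith
  set M : ℝ := (Fintype.card (EdgeType N) : ℝ) with hM
  have hMN : M = N * (N - 1) / 2 := card_edgeType N
  have hN0 : (0 : ℝ) < N := by linarith
  have hM0 : 0 < M := by
    rw [hMN]
    have : (0 : ℝ) < N - 1 := by linarith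
    positivity
  have hdens : ∀ k : ℕ, dens N k = k / M := fun k => rfl
  set x : ℝ := d / N with hx
  have hxN : x * N = d := by rw [hx]; field_simp
  have hx0 : 0 < x := by positivity
  have hxη : x ≤ η / 8 := by rw [hx, div_le_iff₀ hN0]; exact hdN
  have hinv : 1 / M ≤ η / 4 * x := by
    have h1 : η / 4 * x * (N * (N - 1) / 2) = η * d * ((N - 1) / 8) := by
      rw [← hxN]; ring
    rw [div_le_iff₀ hM0, hMN, h1]
    exact one_le_mul_of_one_le_of_one_le hηd (by linarith)
  set m := ⌊(1 - η) * M * x⌋₊ with hm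
  set m' := ⌈(1 + η) * M * x⌉₊ with hm'
  have hmle : (m : ℝ) ≤ (1 - η) * M * x := Nat.floor_le (by
    have : 0 ≤ 1 - η := by linarith
    positivity)
  have hmge : (1 - η) * M * x - 1 ≤ m := (Nat.sub_one_lt_floor _).le
  have hm'ge : (1 + η) * M * x ≤ m' := Nat.le_ceil _
  have hm'le : (m' : ℝ) ≤ (1 + η) * M * x + 1 := (Nat.ceil_lt_add_one (by positivity)).le
  have hp1 : (1 - η) * x - η / 4 * x ≤ dens N m := by
    rw [hdens, le_div_iff₀ hM0]
    rw [div_le_iff₀ hM0] at hinv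
    linarith
  have hp2 : dens N m ≤ (1 - η) * x := by
    rw [hdens, div_le_iff₀ hM0]
    linarith
  have hp3 : (1 + η) * x ≤ dens N m' := by
    rw [hdens, le_div_iff₀ hM0]
    linarith
  have hp4 : dens N m' ≤ (1 + 2 * η) * x := by
    rw [hdens, div_le_iff₀ hM0]
    rw [div_le_iff₀ hM0] at hinv
    linarith [mul_pos (mul_pos hη0 hx0) hM0]
  have hxd : x ≤ η * d / 40 := by
    rw [← hxN]
    linarith [mul_le_mul_of_nonneg_left hηN hx0.le]
  have hMge : 100 * (N : ℝ) ≤ η * M * 10 := by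
    rw [hMN]
    linarith [mul_le_mul_of_nonneg_right hηN (show 0 ≤ (N : ℝ) - 1 by linarith)]
  refine ⟨m, m', ?_, ?_, ?_, ?_, ?_, ?_, ?_, ?_⟩
  · have : (m : ℝ) ≤ m' := by
      refine hmle.trans (le_trans ?_ hm'ge)
      gcongr
      linarith
    exact_mod_cast this
  · have h1 : dens N m' ≤ 1 := hp4.trans (by
      calc (1 + 2 * η) * x ≤ 2 * (1 / 2) := by gcongr <;> linarith
        _ = 1 := by norm_num)
    rw [hdens, div_le_one hM0, hM] at h1
    exact_mod_cast h1
  · have h1 : ((1 - η) * x - η / 4 * x) * (N - 1) ≤ dens N m * (N - 1) :=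
      mul_le_mul_of_nonneg_right hp1 (by linarith)
    refine le_trans ?_ h1
    have h2 : ((1 - η) * x - η / 4 * x) * (N - 1) = (1 - 5 / 4 * η) * d - (1 - 5 / 4 * η) * x := by
      rw [← hxN]; ring
    have h3 : 3 * ε / 20 = 3 * η := by rw [hη]; ring
    rw [h2, h3]
    linarith [mul_pos hη0 hx0]
  · rw [mul_div_assoc]
    refine le_trans ?_ hp1
    linarith [mul_le_mul_of_nonneg_right hη1 hx0.le]
  · rw [mul_div_assoc]
    refine hp4.trans (le_of_eq ?_)
    rw [hη]; ring
  · have h1 : ((1 + η) * x) * (N - 1) ≤ dens N m' * (N - 1) :=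
      mul_le_mul_of_nonneg_right hp3 (by linarith)
    refine le_trans ?_ h1
    have h2 : ((1 + η) * x) * (N - 1) = (1 + η) * d - (1 + η) * x := by
      rw [← hxN]; ring
    have h3 : ε / 40 = η / 2 := by rw [hη]; ring
    rw [h2, h3]
    have h4 : (1 + η) * x ≤ 2 * x := by gcongr; linarith
    linarith
  · have h1 : (1 - η) * M * x ≤ 1 * M * (1 / 2) := by
      gcongr <;> linarith
    have h2 : η * M ≤ 1 / 200 * M := by gcongr
    linarith
  · have h3 : ε / 40 = η / 2 := by rw [hη]; ring
    have h4 : (1 - η / 2) * M ≤ M - m - N := by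
      have h1 : (1 - η) * M * x ≤ 1 * M * (η / 8) := by
        gcongr
        linarith
      linarith
    have h5 : 0 < (1 - η / 2) * M := mul_pos (by linarith) hM0
    rw [h3, mul_div_assoc', div_le_iff₀ (by linarith), ← hxN]
    calc (N : ℝ) * m ≤ N * ((1 - η) * M * x) := by gcongr
      _ ≤ (1 - η / 2) * (x * N) * ((1 - η / 2) * M) := by
          have : 0 ≤ N * M * x * η ^ 2 := by positivity
          linarith
      _ ≤ _ := by
          have : 0 ≤ 1 - η / 2 := by linarith
          gcongr

/-- The total failure probability, in terms of `d = log N`. -/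
def failureBound (ε γ d : ℝ) : ℝ :=
  (Real.exp (Real.exp (-(2 * d))) - 1) + Real.exp (-Real.exp d) +
    8 / γ * Real.exp (-(ε ^ 2 / 2000 * d)) + 3 * ((4 * d) ^ 4 * Real.exp (-(3 / 5 * d))) +
    Real.exp (-(ε / 40 * d)) + (Real.exp (-(ε / 40 * d)) + d * Real.exp (-d))

lemma tendsto_failureBound {ε γ : ℝ} (hε0 : 0 < ε) :
    Tendsto (failureBound ε γ) atTop (nhds 0) := by
  have hexp : ∀ c : ℝ, 0 < c → Tendsto (fun d : ℝ => Real.exp (-(c * d))) atTop (nhds 0) :=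
    fun c hc => Real.tendsto_exp_neg_atTop_nhds_zero.comp (tendsto_id.const_mul_atTop hc)
  have h1 : Tendsto (fun d : ℝ => Real.exp (Real.exp (-(2 * d))) - 1) atTop (nhds 0) := by
    have h := hexp 2 two_pos
    have h2 := ((Real.continuous_exp.tendsto 0).comp h).sub_const 1
    simpa [Function.comp_def] using h2
  have h2 : Tendsto (fun d : ℝ => Real.exp (-Real.exp d)) atTop (nhds 0) :=
    Real.tendsto_exp_neg_atTop_nhds_zero.comp Real.tendsto_exp_atTop
  have h3 : Tendsto (fun d : ℝ => (4 * d) ^ 4 * Real.exp (-(3 / 5 * d))) atTop (nhds 0) := by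
    have h := (Real.tendsto_pow_mul_exp_neg_atTop_nhds_zero 4).comp
      (tendsto_id.const_mul_atTop (show (0 : ℝ) < 3 / 5 by norm_num))
    have h' := h.const_mul ((20 / 3) ^ 4 : ℝ)
    rw [mul_zero] at h'
    refine h'.congr fun d => ?_
    simp only [Function.comp_def, id]
    ring
  have h4 : Tendsto (fun d : ℝ => d * Real.exp (-d)) atTop (nhds 0) := by
    simpa using Real.tendsto_pow_mul_exp_neg_atTop_nhds_zero 1
  have h := ((((h1.add h2).add ((hexp (ε ^ 2 / 2000) (by positivity)).const_mul (8 / γ))).add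
    (h3.const_mul 3)).add (hexp (ε / 40) (by positivity))).add
    ((hexp (ε / 40) (by positivity)).add h4)
  simp only [mul_zero, add_zero] at h
  exact h

end Asymptotics

section HittingTime

variable {N : ℕ}

/-- The graph at the step at which the last isolated vertex disappears. -/
def hittingGraph (σ : ProcessSpace N) : SimpleGraph (Fin N) :=
  processGraph σ (sInf {m : ℕ | ∀ v, 1 ≤ deg (processGraph σ m) v})

lemma hittingGraph_between {σ : ProcessSpace N} {m m' : ℕ}
    (h : ∃ v, deg (processGraph σ m) v = 0) (h' : ∀ v, deg (processGraph σ m') v ≠ 0) :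
    processGraph σ m ≤ hittingGraph σ ∧ hittingGraph σ ≤ processGraph σ m' ∧
      ∀ v, 1 ≤ deg (hittingGraph σ) v := by
  set s : Set ℕ := {m : ℕ | ∀ v, 1 ≤ deg (processGraph σ m) v} with hs
  have hm' : m' ∈ s := fun v => Nat.one_le_iff_ne_zero.2 (h' v)
  have hmem : sInf s ∈ s := Nat.sInf_mem ⟨m', hm'⟩
  refine ⟨processGraph_mono σ ?_, processGraph_mono σ (Nat.sInf_le hm'), hmem⟩
  by_contra! hlt
  obtain ⟨v, hv⟩ := h
  have h1 : deg (processGraph σ (sInf s)) v ≤ deg (processGraph σ m) v :=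
    deg_mono (processGraph_mono σ hlt.le) v
  have h2 : 1 ≤ deg (processGraph σ (sInf s)) v := hmem v
  omega

lemma Pr_not_resilient_hittingGraph_le {ε γ : ℝ} (hε0 : 0 < ε) (hε : ε ≤ 1 / 10)
    (hγ : γ = Real.exp (-(8 / (ε / 100))) / 2) :
    ∀ᶠ N : ℕ in atTop, Even N →
      Pr (fun σ : ProcessSpace N =>
        ¬ Resilient (hittingGraph σ) (1 / 2 - ε) HasNearPerfectMatching) ≤
        failureBound ε γ (Real.log N) := by
  have hγ0 : 0 < γ := by rw [hγ]; positivity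
  have hγε : γ ≤ ε / 20 := by
    have h1 := Real.add_one_le_exp (8 / (ε / 100))
    rw [hγ, Real.exp_neg, div_le_iff₀ two_pos, inv_le_comm₀ (Real.exp_pos _) (by positivity)]
    refine le_trans ?_ h1
    have : 8 / (ε / 100) = 80 * (ε / 20 * 2)⁻¹ := by field_simp; norm_num
    rw [this]
    have : 0 < (ε / 20 * 2)⁻¹ := by positivity
    linarith
  filter_upwards [eventually_exists_steps hε0 hε,
    tendsto_log_natCast.eventually_ge_atTop
      (max 1000 (max (160 / ε ^ 2) (800 * (Real.log 4 + 1) / (ε ^ 2 * γ)))),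
    tendsto_natCast_atTop_atTop.eventually_ge_atTop (max 1000 (8 / γ))] with N hsteps hd hN hNeven
  obtain ⟨m, m', hmm', hm', h1, h2, h3, h4, h5, h6⟩ := hsteps
  set d := Real.log N with hdef
  have hm := hmm'.trans hm'
  have hd1000 : 1000 ≤ d := (le_max_left _ _).trans hd
  have hdK : 40 / ε ≤ ε / 4 * d := by
    have := ((le_max_left _ _).trans (le_max_right _ _)).trans hd
    calc 40 / ε = ε / 4 * (160 / ε ^ 2) := by field_simp; norm_num
      _ ≤ _ := by gcongr
  have hdγ : Real.log 4 + 1 ≤ ε ^ 2 / 100 * (γ / 8 * d) := by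
    have := ((le_max_right _ _).trans (le_max_right _ _)).trans hd
    rw [div_le_iff₀ (by positivity)] at this
    linarith
  have hN1000 : (1000 : ℝ) ≤ N := (le_max_left _ _).trans hN
  have hNγ : 8 ≤ γ * N := by
    have := (le_max_right _ _).trans hN
    rw [div_le_iff₀ hγ0] at this
    linarith
  have hN1000' : 1000 ≤ N := by exact_mod_cast hN1000
  have hN0 : (0 : ℝ) < N := by linarith
  have hexpd : Real.exp d = N := Real.exp_log hN0
  have hd0 : 0 ≤ d := by linarith
  set t := ⌈γ / 8 * N⌉₊ with ht
  have htge : γ / 8 * N ≤ t := Nat.le_ceil _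
  have htle : (t : ℝ) ≤ γ / 4 * N := by
    have := (Nat.ceil_lt_add_one (show 0 ≤ γ / 8 * N by positivity)).le
    linarith
  have ht0 : 0 < t := Nat.ceil_pos.2 (by positivity)
  have hp2 : dens N m' ≤ 2 * d / N := h3.trans (by gcongr; linarith)
  have b1 := Pr_exists_sum_degIn_self_lt hm' (θ := ε / 100) (by positivity) hd0 hp2
  rw [← hγ] at b1
  have b2 := Pr_exists_sum_degIn_lt_of_disjoint (t := t) hm' hε0 hε (by omega) hd0 h3
  have b3 := Pr_many_deg_lt hm hε0 hε hγ0 (by omega) hd0 h1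
  have b4 := Pr_exists_tiny_adj hm hm' (by linarith) hN1000' h2 hp2
  have b5 := Pr_exists_tiny_common hm hm' (by linarith) hN1000' h2 hp2
  have b6 := Pr_exists_tiny_path hm hm' (by linarith) hN1000' h2 hp2
  have b7 := Pr_exists_deg_eq_zero hm' (by omega)
  have b8 := Pr_forall_deg_ne_zero_le hm (by omega) h5
  refine (Pr_mono fun σ hσ => ?_).trans ((Pr_or _ _).trans (add_le_add ((Pr_or _ _).trans
    (add_le_add ((Pr_or _ _).trans (add_le_add ((Pr_or _ _).trans (add_le_add
    ((Pr_or _ _).trans (add_le_add (b1.trans ?_) (b2.trans ?_))) b3)) (((Pr_or _ _).trans (add_le_add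
    ((Pr_or _ _).trans (add_le_add b4 b5)) b6)).trans ?_))) (b7.trans ?_))) (b8.trans ?_)))
  · by_contra! hcon
    obtain ⟨⟨⟨⟨⟨c1, c2⟩, c3⟩, ⟨c4, c5⟩, c6⟩, c7⟩, c8⟩ := hcon
    obtain ⟨hle, hge, hmin⟩ := hittingGraph_between c8 c7
    refine hσ (Pseudorandom.resilient (γ := γ) (d := d) (t := t) ?_ hd1000 hε0 hε hle hge hmin ht0
      hγ0 hγε (by simpa using htle) hdK (by simpa using hNeven))
    exact
      { sparse := fun X hX => c1 X (by simpa using hX)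
        few_small := by simpa using c3
        uniform := fun T B hTB hT hB => c2 T B hTB hT (by simpa using hB)
        tiny_adj := c4
        tiny_common := fun u v huv hu hv w => c5 u v w huv hu hv
        tiny_path := fun u v hu hv x w y hnd => c6 u v x w y hnd hu hv }
  · have : N * Real.exp (-3 * d) = Real.exp (-(2 * d)) := by
      rw [← hexpd, ← Real.exp_add]
      congr 1; ring
    rw [this]
  · have h4N : (4 : ℝ) ^ N = Real.exp (N * Real.log 4) := by
      rw [Real.exp_nat_mul, Real.exp_log (by norm_num)]
    rw [h4N, ← Real.exp_add, hexpd]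
    apply Real.exp_le_exp.2
    have h7 : N * (Real.log 4 + 1) ≤ N * (ε ^ 2 / 100 * (γ / 8 * d)) := by gcongr
    have h8 : ε ^ 2 / 100 * (γ / 8 * N * d) ≤ ε ^ 2 / 100 * (t * d) := by gcongr
    linarith
  · have : Real.exp (-(3 / 5 * d)) = N * Real.exp (-(8 / 5 * d)) := by
      rw [← hexpd, ← Real.exp_add]
      congr 1; ring
    rw [this]
    linarith
  · nth_rewrite 1 [← hexpd]
    rw [← Real.exp_add]
    apply Real.exp_le_exp.2
    linarith
  · refine add_le_add ?_ ?_
    · rw [← hexpd, ← Real.exp_sub, hexpd]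
      apply Real.exp_le_exp.2
      linarith
    · rw [Real.exp_neg, hexpd, ← div_eq_mul_inv, le_div_iff₀ hN0, mul_comm]
      refine h6.trans ?_
      have : 0 ≤ ε / 40 * d := by positivity
      linarith

lemma Resilient.mono {V : Type*} {G : SimpleGraph V} {α β : ℝ} {P : SimpleGraph V → Prop}
    (h : Resilient G β P) (hαβ : α ≤ β) : Resilient G α P := by
  intro H hH hdeg
  exact h H hH fun v => (hdeg v).trans (by gcongr)

lemma processMeasure_apply (N : ℕ) (P : ProcessSpace N → Prop) :
    processMeasure N {σ | P σ} = ENNReal.ofReal (Pr P) := by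
  classical
  have : Nonempty (ProcessSpace N) := ⟨(Fintype.equivFin _).symm⟩
  have hc : 0 < (Fintype.card (ProcessSpace N) : ℝ) := by exact_mod_cast Fintype.card_pos
  rw [processMeasure, Measure.smul_apply, Measure.sum_apply _ MeasurableSpace.measurableSet_top,
    tsum_fintype, Pr_eq_Ex, Ex, ENNReal.ofReal_div_of_pos hc, ENNReal.ofReal_natCast, smul_eq_mul,
    ENNReal.div_eq_inv_mul, ENNReal.ofReal_sum_of_nonneg fun _ _ => by positivity]
  congr 1
  refine Finset.sum_congr rfl fun σ _ => ?_
  rw [Measure.dirac_apply' _ MeasurableSpace.measurableSet_top]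
  by_cases h : P σ <;> simp [h]

end HittingTime

theorem statement_1 (ε : ℝ) (hε : 0 < ε) :
    Tendsto (fun n : ℕ =>
      processMeasure (2 * n) {σ : ProcessSpace (2 * n) |
        Resilient (processGraph σ (sInf {m : ℕ | ∀ v, 1 ≤ deg (processGraph σ m) v}))
          (1 / 2 - ε) HasNearPerfectMatching})
      atTop (nhds 1) := by
  set δ := min ε (1 / 10) with hδ
  have hδ0 : 0 < δ := lt_min hε (by norm_num)
  have hδε : δ ≤ ε := min_le_left _ _
  set P : ∀ N : ℕ, ProcessSpace N → Prop :=
    fun N σ => Resilient (hittingGraph σ) (1 / 2 - ε) HasNearPerfectMatching with hP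
  set γ : ℝ := Real.exp (-(8 / (δ / 100))) / 2 with hγ
  have hdouble : Tendsto (fun n : ℕ => 2 * n) atTop atTop :=
    tendsto_id.const_mul_atTop' two_pos
  have hsum : ∀ N, Pr (P N) + Pr (fun σ => ¬ P N σ) = 1 := by
    intro N
    have : Nonempty (ProcessSpace N) := ⟨(Fintype.equivFin _).symm⟩
    exact Pr_add_Pr_not _
  have hlower : ∀ᶠ n : ℕ in atTop,
      1 - failureBound δ γ (Real.log ((2 * n : ℕ) : ℝ)) ≤ Pr (P (2 * n)) := by
    filter_upwards [hdouble.eventually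
      (Pr_not_resilient_hittingGraph_le hδ0 (min_le_right _ _) hγ)] with n hn
    have h1 := hn (even_two_mul n)
    have h2 : Pr (fun σ => ¬ P (2 * n) σ) ≤ Pr (fun σ : ProcessSpace (2 * n) =>
        ¬ Resilient (hittingGraph σ) (1 / 2 - δ) HasNearPerfectMatching) :=
      Pr_mono fun σ hσ h => hσ (Resilient.mono h (by linarith))
    linarith [hsum (2 * n)]
  have hlim : Tendsto (fun n : ℕ => Pr (P (2 * n))) atTop (nhds 1) := by
    refine tendsto_of_tendsto_of_tendsto_of_le_of_le' ?_ tendsto_const_nhds hlower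
      (Eventually.of_forall fun n => by linarith [hsum (2 * n), Pr_nonneg (fun σ => ¬ P (2 * n) σ)])
    simpa using ((tendsto_failureBound (γ := γ) hδ0).comp
      (tendsto_log_natCast.comp hdouble)).const_sub 1
  have h := ENNReal.tendsto_ofReal hlim
  rw [ENNReal.ofReal_one] at h
  exact h.congr fun n => (processMeasure_apply _ _).symm

end
end RGP
end

section
/- Let k ≥ 2 be an integer and ε > 0 a constant. There exists a positive constant δ = δ(ε) such that if p₀ = p₀(n) ≥ (1+ε)·log n/(kn) and p' = p'(n) ≤ ε·p₀, then asymptotically almost surely the following holds for G⁻ ∼ G_{n,p₀}, G⁺ = G⁻ ∪ G_{n,p'}, and p₁ = 1 − (1−p₀)(1−p'): every cycle C ⊆ G⁺ with at most 2k vertices satisfies |V(C) ∩ (TINY_{p₀,δ}(G⁻) ∪ TINY_{p₁,δ}(G⁺))| ≤ k − 2. -/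
open MeasureTheory Filter ENNReal

namespace RGP

noncomputable section

variable {V : Type*}

/-- The real-valued Bernoulli product weight of an outcome. -/
def bernoulliWeight {n : ℕ} (p : ℝ) (ω : GnpSpace n) : ℝ :=
  ∏ e : EdgeType n, (if ω e then p else 1 - p)

lemma bernoulliWeight_nonneg {n : ℕ} {p : ℝ} (hp0 : 0 ≤ p) (hp1 : p ≤ 1) (ω : GnpSpace n) :
    0 ≤ bernoulliWeight p ω :=
  Finset.prod_nonneg fun e _ => by split_ifs <;> linarith

lemma gnpWeight_eq_ofReal {n : ℕ} {p : ℝ} (hp0 : 0 ≤ p) (hp1 : p ≤ 1) (ω : GnpSpace n) :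
    gnpWeight p ω = ENNReal.ofReal (bernoulliWeight p ω) := by
  unfold gnpWeight bernoulliWeight
  rw [ENNReal.ofReal_prod_of_nonneg]
  · exact Finset.prod_congr rfl fun e _ => by split_ifs <;> rfl
  · intro e _
    split_ifs <;> linarith

lemma gnp2_apply {n : ℕ} {p q : ℝ} (hp0 : 0 ≤ p) (hp1 : p ≤ 1) (hq0 : 0 ≤ q) (hq1 : q ≤ 1)
    (A : Set (GnpSpace n × GnpSpace n)) :
    gnp2 n p q A = ENNReal.ofReal
      (∑ ω, A.indicator (fun ω => bernoulliWeight p ω.1 * bernoulliWeight q ω.2) ω) := by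
  classical
  have hnn : ∀ ω : GnpSpace n × GnpSpace n,
      0 ≤ bernoulliWeight p ω.1 * bernoulliWeight q ω.2 := fun ω =>
    mul_nonneg (bernoulliWeight_nonneg hp0 hp1 _) (bernoulliWeight_nonneg hq0 hq1 _)
  unfold gnp2
  rw [Measure.sum_apply _ (Set.toFinite A).measurableSet, tsum_fintype,
    ENNReal.ofReal_sum_of_nonneg fun ω _ => Set.indicator_nonneg (fun ω _ => hnn ω) ω]
  refine Finset.sum_congr rfl fun ω _ => ?_
  rw [Measure.smul_apply, Measure.dirac_apply' _ (Set.toFinite A).measurableSet,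
    gnpWeight_eq_ofReal hp0 hp1, gnpWeight_eq_ofReal hq0 hq1,
    ← ENNReal.ofReal_mul (bernoulliWeight_nonneg hp0 hp1 _)]
  by_cases h : ω ∈ A <;> simp [h]

lemma sum_prod_edges {n : ℕ} (f : EdgeType n → Bool → Bool → ℝ) :
    ∑ ω : GnpSpace n × GnpSpace n, ∏ e, f e (ω.1 e) (ω.2 e) =
      ∏ e, ∑ b : Bool × Bool, f e b.1 b.2 := by
  classical
  rw [Finset.prod_univ_sum, Fintype.piFinset_univ]
  exact (Fintype.sum_equiv (Equiv.arrowProdEquivProdArrow (EdgeType n) (fun _ => Bool)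
    (fun _ => Bool)) _ _ fun ω => rfl).symm

lemma sum_bernoulliWeight {n : ℕ} (p q : ℝ) :
    ∑ ω : GnpSpace n × GnpSpace n, bernoulliWeight p ω.1 * bernoulliWeight q ω.2 = 1 := by
  have h := sum_prod_edges (n := n) fun _ b b' =>
    (if b then p else 1 - p) * (if b' then q else 1 - q)
  simp only [Finset.prod_mul_distrib] at h
  refine h.trans (Finset.prod_eq_one fun e _ => ?_)
  simp [Fintype.sum_prod_type]
  ring

/-- The number of edges at `v` that are open in `ω`. -/
def openCount {n : ℕ} (v : Fin n) (ω : GnpSpace n) : ℕ :=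
  (Finset.univ.filter fun e : EdgeType n => v ∈ (e : Sym2 (Fin n)) ∧ ω e = true).card

/-- The expectation of `2 ^ (-openCount v)` on the event that all edges of `S` are open in the
union of the two graphs. -/
lemma sum_weight_open_le {n : ℕ} {p q : ℝ} (hp0 : 0 ≤ p) (hp1 : p ≤ 1) (hq0 : 0 ≤ q) (hq1 : q ≤ 1)
    (v : Fin n) (S : Finset (EdgeType n)) :
    ∑ ω : GnpSpace n × GnpSpace n, bernoulliWeight p ω.1 * bernoulliWeight q ω.2 *
        ((if ∀ e ∈ S, ω.1 e = true ∨ ω.2 e = true then 1 else 0) *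
          (1 / 2 : ℝ) ^ openCount v ω.1) ≤
      (p + q) ^ S.card * (1 - p / 2) ^
        (Finset.univ.filter fun e : EdgeType n => v ∈ (e : Sym2 (Fin n)) ∧ e ∉ S).card := by
  classical
  have h := sum_prod_edges (n := n) fun e b b' =>
    (if b then p else 1 - p) * (if b' then q else 1 - q) *
      ((if e ∈ S → (b = true ∨ b' = true) then 1 else 0) *
        (if v ∈ (e : Sym2 (Fin n)) ∧ b = true then (1 / 2 : ℝ) else 1))
  simp only [Finset.prod_mul_distrib] at h
  have hL : ∀ ω : GnpSpace n × GnpSpace n,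
      (∏ e : EdgeType n, (if e ∈ S → (ω.1 e = true ∨ ω.2 e = true) then (1 : ℝ) else 0)) *
        ∏ e : EdgeType n, (if v ∈ (e : Sym2 (Fin n)) ∧ ω.1 e = true then (1 / 2 : ℝ) else 1) =
      (if ∀ e ∈ S, ω.1 e = true ∨ ω.2 e = true then 1 else 0) *
          (1 / 2 : ℝ) ^ openCount v ω.1 := by
    intro ω
    rw [Finset.prod_ite_zero, Finset.prod_ite, Finset.prod_const, Finset.prod_const_one]
    simp [openCount]
  simp only [hL] at h
  have hR : (p + q) ^ S.card * (1 - p / 2) ^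
        (Finset.univ.filter fun e : EdgeType n => v ∈ (e : Sym2 (Fin n)) ∧ e ∉ S).card =
      ∏ e : EdgeType n, (if e ∈ S then p + q else 1) *
        (if v ∈ (e : Sym2 (Fin n)) ∧ e ∉ S then 1 - p / 2 else 1) := by
    rw [Finset.prod_mul_distrib, Finset.prod_ite, Finset.prod_ite]
    simp
  rw [hR]
  refine (le_of_eq h).trans (Finset.prod_le_prod (fun e _ => Finset.sum_nonneg fun b _ => ?_)
    fun e _ => ?_)
  · refine mul_nonneg (mul_nonneg ?_ ?_) (mul_nonneg ?_ ?_) <;> split_ifs <;> linarith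
  · by_cases he : e ∈ S <;> by_cases hv : v ∈ (e : Sym2 (Fin n)) <;>
      simp [Fintype.sum_prod_type, he, hv] <;> nlinarith [mul_nonneg hp0 hq0]

lemma openCount_le_deg {n : ℕ} (v : Fin n) (ω : GnpSpace n) :
    openCount v ω ≤ deg (gnpGraph ω) v := by
  classical
  unfold openCount deg
  rw [← Set.ncard_coe_finset]
  refine Set.ncard_le_ncard_of_injOn
    (fun e => if h : v ∈ (e : Sym2 (Fin n)) then Sym2.Mem.other h else v) ?_ ?_ (Set.toFinite _)
  · intro e he
    simp only [Finset.coe_filter, Finset.mem_univ, true_and, Set.mem_ofPred_eq] at he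
    simp only [he.1, dif_pos, SimpleGraph.mem_neighborSet, gnpGraph,
      SimpleGraph.fromEdgeSet_adj, Set.mem_ofPred_eq, Sym2.other_spec]
    exact ⟨⟨e.2, he.2⟩, (Sym2.other_ne e.2 he.1).symm⟩
  · intro e he f hf hef
    simp only [Finset.coe_filter, Finset.mem_univ, true_and, Set.mem_ofPred_eq] at he hf
    simp only [he.1, hf.1, dif_pos] at hef
    refine Subtype.ext ?_
    rw [← Sym2.other_spec he.1, ← Sym2.other_spec hf.1, hef]

lemma le_card_incident {n : ℕ} (v : Fin n) (S : Finset (EdgeType n)) :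
    n ≤ (Finset.univ.filter fun e : EdgeType n => v ∈ (e : Sym2 (Fin n)) ∧ e ∉ S).card
      + S.card + 1 := by
  classical
  have h1 : (Finset.univ.erase v).card ≤
      (Finset.univ.filter fun e : EdgeType n => v ∈ (e : Sym2 (Fin n))).card := by
    refine Finset.card_le_card_of_surjOn
      (fun e => if h : v ∈ (e : Sym2 (Fin n)) then Sym2.Mem.other h else v) fun u hu => ?_
    have hu : v ≠ u := by simpa [eq_comm] using hu
    have hv : v ∈ s(v, u) := Sym2.mem_mk_left v u
    refine ⟨⟨s(v, u), by simpa using hu⟩, by simp, ?_⟩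
    have h := Sym2.other_spec hv
    simp only [hv, dif_pos]
    exact Sym2.congr_right.1 h
  have h2 : (Finset.univ.filter fun e : EdgeType n => v ∈ (e : Sym2 (Fin n))).card ≤
      (Finset.univ.filter fun e : EdgeType n => v ∈ (e : Sym2 (Fin n)) ∧ e ∉ S).card + S.card := by
    refine (Finset.card_le_card fun e he => ?_).trans (Finset.card_union_le _ _)
    by_cases hS : e ∈ S <;> simp_all
  rw [Finset.card_erase_of_mem (Finset.mem_univ v), Finset.card_univ, Fintype.card_fin] at h1
  omega

lemma card_finsetWalkLength_le {n : ℕ} (G : SimpleGraph (Fin n)) [DecidableRel G.Adj]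
    (l : ℕ) (u v : Fin n) :
    (G.finsetWalkLength (l + 1) u v).card ≤ n ^ l := by
  induction l generalizing u with
  | zero =>
    rw [pow_zero, Finset.card_le_one]
    intro p hp q hq
    rw [SimpleGraph.mem_finsetWalkLength_iff] at hp hq
    cases p with
    | nil => simp at hp
    | cons h p =>
      cases q with
      | nil => simp at hq
      | cons h' q =>
        cases p with
        | cons _ _ => simp at hp
        | nil =>
          cases q with
          | cons _ _ => simp at hq
          | nil => rfl
  | succ l ih =>
    rw [SimpleGraph.finsetWalkLength]
    refine Finset.card_biUnion_le.trans ?_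
    simp only [Finset.card_map]
    refine (Finset.sum_le_card_nsmul _ _ (n ^ l) fun w _ => ih _).trans ?_
    rw [smul_eq_mul, pow_succ']
    refine Nat.mul_le_mul_right _ ?_
    exact (Fintype.card_subtype_le _).trans (by simp)

/-- The edges of a walk, as a finset of potential edges. -/
def walkEdges {n : ℕ} {u v : Fin n} (c : (⊤ : SimpleGraph (Fin n)).Walk u v) :
    Finset (EdgeType n) :=
  c.edges.toFinset.subtype fun e => ¬ e.IsDiag

lemma card_walkEdges {n : ℕ} {u v : Fin n} {c : (⊤ : SimpleGraph (Fin n)).Walk u v}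
    (hc : c.IsTrail) : (walkEdges c).card = c.length := by
  rw [walkEdges, Finset.card_subtype, Finset.filter_true_of_mem, List.toFinset_card_of_nodup
    hc.edges_nodup, SimpleGraph.Walk.length_edges]
  intro e he
  exact SimpleGraph.not_isDiag_of_mem_edgeSet _ (c.edges_subset_edgeSet (List.mem_toFinset.1 he))

/-- The outcomes for which a vertex of degree less than `a` in the first graph lies on a cycle of
length at most `m` in the union. -/
def lowDegreeOnCycle (n m : ℕ) (a : ℝ) : Set (GnpSpace n × GnpSpace n) :=
  {ω | ∃ (v : Fin n) (c : (gnpGraph ω.1 ⊔ gnpGraph ω.2).Walk v v),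
    c.IsCycle ∧ c.length ≤ m ∧ (deg (gnpGraph ω.1) v : ℝ) < a}

open Classical in
lemma indicator_lowDegreeOnCycle_le {n m : ℕ} {a : ℝ} (ω : GnpSpace n × GnpSpace n) :
    (lowDegreeOnCycle n m a).indicator (fun _ => (1 : ℝ)) ω ≤
      ∑ v : Fin n, ∑ l ∈ Finset.range m,
        ∑ c ∈ ((⊤ : SimpleGraph (Fin n)).finsetWalkLength (l + 1) v v).filter
          (fun c => c.IsTrail),
          Real.exp a * ((if ∀ e ∈ walkEdges c, ω.1 e = true ∨ ω.2 e = true then 1 else 0) *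
            (1 / 2 : ℝ) ^ openCount v ω.1) := by
  have hnn : ∀ (v : Fin n) (c : (⊤ : SimpleGraph (Fin n)).Walk v v), 0 ≤
      Real.exp a * ((if ∀ e ∈ walkEdges c, ω.1 e = true ∨ ω.2 e = true then 1 else 0) *
            (1 / 2 : ℝ) ^ openCount v ω.1) := by
    intro v c
    positivity
  by_cases h : ω ∈ lowDegreeOnCycle n m a
  swap
  · rw [Set.indicator_of_notMem h]
    exact Finset.sum_nonneg fun v _ => Finset.sum_nonneg fun l _ =>
      Finset.sum_nonneg fun c _ => hnn v c
  rw [Set.indicator_of_mem h]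
  obtain ⟨v, c, hc, hl, hd⟩ := h
  have hpos : 0 < c.length := by have := hc.three_le_length; omega
  set c' := c.mapLe (le_top : _ ≤ (⊤ : SimpleGraph (Fin n))) with hc'
  have hlen : c'.length = c.length := by simp [hc', SimpleGraph.Walk.mapLe]
  have htrail : c'.IsTrail := (hc.mapLe _).isTrail
  have hopen : ∀ e ∈ walkEdges c', ω.1 e = true ∨ ω.2 e = true := by
    intro e he
    have he : (e : Sym2 (Fin n)) ∈ c.edges := by simpa [walkEdges, hc'] using he
    have := c.edges_subset_edgeSet he
    rw [SimpleGraph.edgeSet_sup] at this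
    refine this.imp ?_ ?_ <;> intro h <;>
    · simp only [gnpGraph, SimpleGraph.edgeSet_fromEdgeSet] at h
      exact h.1.2
  have hone : (1 : ℝ) ≤ Real.exp a *
      ((if ∀ e ∈ walkEdges c', ω.1 e = true ∨ ω.2 e = true then 1 else 0) *
            (1 / 2 : ℝ) ^ openCount v ω.1) := by
    have hcnt : (openCount v ω.1 : ℝ) ≤ a :=
      (Nat.cast_le.2 (openCount_le_deg v ω.1)).trans hd.le
    have h2 : Real.exp (-1) ≤ 1 / 2 := by
      have h3 := Real.add_one_le_exp (1 : ℝ)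
      rw [Real.exp_neg, inv_eq_one_div]
      exact one_div_le_one_div_of_le (by norm_num) (by linarith)
    rw [if_pos hopen, one_mul]
    calc (1 : ℝ) ≤ Real.exp (a + (openCount v ω.1 : ℝ) * (-1)) :=
          Real.one_le_exp (by linarith)
      _ = Real.exp a * Real.exp (-1) ^ openCount v ω.1 := by
          rw [Real.exp_add, Real.exp_nat_mul]
      _ ≤ _ := by gcongr
  refine hone.trans ?_
  refine le_trans ?_ (Finset.single_le_sum (fun v _ => Finset.sum_nonneg fun l _ =>
      Finset.sum_nonneg fun c _ => hnn v c) (Finset.mem_univ v))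
  refine le_trans ?_ (Finset.single_le_sum (fun l _ =>
      Finset.sum_nonneg fun c _ => hnn v c)
      (Finset.mem_range.2 (show c.length - 1 < m by omega)))
  refine Finset.single_le_sum (f := fun c => Real.exp a *
      ((if ∀ e ∈ walkEdges c, ω.1 e = true ∨ ω.2 e = true then 1 else 0) *
            (1 / 2 : ℝ) ^ openCount v ω.1)) (fun c _ => hnn v c) ?_
  rw [Finset.mem_filter, SimpleGraph.mem_finsetWalkLength_iff]
  exact ⟨by omega, htrail⟩

lemma one_sub_half_pow_le {p : ℝ} (hp0 : 0 ≤ p) (hp1 : p ≤ 1) {n N M : ℕ} (h : n ≤ N + M) :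
    (1 - p / 2) ^ N ≤ 2 ^ M * Real.exp (-(n * p / 2)) := by
  have hq0 : (0 : ℝ) ≤ 1 - p / 2 := by linarith
  calc (1 - p / 2) ^ N ≤ (1 - p / 2) ^ N * (2 * (1 - p / 2)) ^ M :=
        le_mul_of_one_le_right (pow_nonneg hq0 _) (one_le_pow₀ (by linarith))
    _ = 2 ^ M * (1 - p / 2) ^ (N + M) := by rw [mul_pow, pow_add]; ring
    _ ≤ 2 ^ M * (1 - p / 2) ^ n := by
        gcongr 2 ^ M * ?_
        exact pow_le_pow_of_le_one hq0 (by linarith) h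
    _ ≤ 2 ^ M * Real.exp (-(p / 2)) ^ n := by
        gcongr
        exact Real.one_sub_le_exp_neg _
    _ = _ := by rw [← Real.exp_nat_mul]; ring_nf

lemma sum_weight_lowDegreeOnCycle_le {n m : ℕ} {a p q : ℝ}
    (hp0 : 0 ≤ p) (hp1 : p ≤ 1) (hq0 : 0 ≤ q) (hq1 : q ≤ 1) :
    ∑ ω, (lowDegreeOnCycle n m a).indicator
        (fun ω => bernoulliWeight p ω.1 * bernoulliWeight q ω.2) ω ≤
      ∑ l ∈ Finset.range m,
        2 ^ (m + 1) * (n * (p + q)) ^ (l + 1) * Real.exp (a - n * p / 2) := by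
  classical
  have hW : ∀ ω : GnpSpace n × GnpSpace n,
      0 ≤ bernoulliWeight p ω.1 * bernoulliWeight q ω.2 := fun ω =>
    mul_nonneg (bernoulliWeight_nonneg hp0 hp1 _) (bernoulliWeight_nonneg hq0 hq1 _)
  have hwalk : ∀ (v : Fin n), ∀ l ∈ Finset.range m,
      ∀ c ∈ ((⊤ : SimpleGraph (Fin n)).finsetWalkLength (l + 1) v v).filter
          (fun c => c.IsTrail),
      ∑ ω : GnpSpace n × GnpSpace n, bernoulliWeight p ω.1 * bernoulliWeight q ω.2 *
        (Real.exp a * ((if ∀ e ∈ walkEdges c, ω.1 e = true ∨ ω.2 e = true then 1 else 0) *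
            (1 / 2 : ℝ) ^ openCount v ω.1)) ≤
      Real.exp a * ((p + q) ^ (l + 1) * (2 ^ (m + 1) * Real.exp (-(n * p / 2)))) := by
    intro v l hl c hc
    rw [Finset.mem_filter, SimpleGraph.mem_finsetWalkLength_iff] at hc
    rw [Finset.mem_range] at hl
    have hcard : (walkEdges c).card = l + 1 := (card_walkEdges hc.2).trans hc.1
    have hN := le_card_incident v (walkEdges c)
    simp only [mul_left_comm _ (Real.exp a)]
    rw [← Finset.mul_sum]
    gcongr
    refine (sum_weight_open_le hp0 hp1 hq0 hq1 v (walkEdges c)).trans ?_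
    rw [hcard]
    gcongr
    exact one_sub_half_pow_le hp0 hp1 (by omega)
  calc ∑ ω, (lowDegreeOnCycle n m a).indicator
        (fun ω => bernoulliWeight p ω.1 * bernoulliWeight q ω.2) ω
      = ∑ ω, bernoulliWeight p ω.1 * bernoulliWeight q ω.2 *
          (lowDegreeOnCycle n m a).indicator (fun _ => (1 : ℝ)) ω := by
        refine Finset.sum_congr rfl fun ω _ => ?_
        by_cases h : ω ∈ lowDegreeOnCycle n m a <;> simp [h]
    _ ≤ ∑ ω : GnpSpace n × GnpSpace n, bernoulliWeight p ω.1 * bernoulliWeight q ω.2 *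
          ∑ v : Fin n, ∑ l ∈ Finset.range m,
          ∑ c ∈ ((⊤ : SimpleGraph (Fin n)).finsetWalkLength (l + 1) v v).filter
          (fun c => c.IsTrail),
          (Real.exp a * ((if ∀ e ∈ walkEdges c, ω.1 e = true ∨ ω.2 e = true then 1 else 0) *
            (1 / 2 : ℝ) ^ openCount v ω.1)) :=
        Finset.sum_le_sum fun ω _ =>
          mul_le_mul_of_nonneg_left (indicator_lowDegreeOnCycle_le ω) (hW ω)
    _ = ∑ v : Fin n, ∑ l ∈ Finset.range m,
          ∑ c ∈ ((⊤ : SimpleGraph (Fin n)).finsetWalkLength (l + 1) v v).filter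
          (fun c => c.IsTrail),
          ∑ ω : GnpSpace n × GnpSpace n, bernoulliWeight p ω.1 * bernoulliWeight q ω.2 *
          (Real.exp a * ((if ∀ e ∈ walkEdges c, ω.1 e = true ∨ ω.2 e = true then 1 else 0) *
            (1 / 2 : ℝ) ^ openCount v ω.1)) := by
        simp only [Finset.mul_sum]
        rw [Finset.sum_comm]
        refine Finset.sum_congr rfl fun v _ => ?_
        rw [Finset.sum_comm]
        refine Finset.sum_congr rfl fun l _ => ?_
        rw [Finset.sum_comm]
    _ ≤ ∑ v : Fin n, ∑ l ∈ Finset.range m, (n : ℝ) ^ l *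
          (Real.exp a * ((p + q) ^ (l + 1) * (2 ^ (m + 1) * Real.exp (-(n * p / 2))))) := by
        refine Finset.sum_le_sum fun v _ => Finset.sum_le_sum fun l hl => ?_
        refine (Finset.sum_le_card_nsmul _ _ _ (hwalk v l hl)).trans ?_
        rw [nsmul_eq_mul]
        gcongr
        exact_mod_cast (Finset.card_filter_le _ _).trans (card_finsetWalkLength_le _ l v v)
    _ = _ := by
        rw [Finset.sum_const, Finset.card_univ, Fintype.card_fin, nsmul_eq_mul, Finset.mul_sum]
        refine Finset.sum_congr rfl fun l _ => ?_
        rw [sub_eq_add_neg, Real.exp_add, mul_pow]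
        ring

lemma tendsto_sum_pow_mul_exp_neg {y : ℕ → ℝ} (hy : Tendsto y atTop atTop) (m : ℕ) (C : ℝ) :
    Tendsto (fun n => ∑ l ∈ Finset.range m, C * (4 * y n) ^ (l + 1) * Real.exp (-(y n)))
      atTop (nhds 0) := by
  rw [← Finset.sum_const_zero (ι := ℕ) (s := Finset.range m)]
  refine tendsto_finsetSum _ fun l _ => ?_
  have h := (((Real.tendsto_pow_mul_exp_neg_atTop_nhds_zero (l + 1)).comp hy).const_mul
    (C * 4 ^ (l + 1)))
  rw [mul_zero] at h
  refine h.congr fun n => ?_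
  simp only [Function.comp, mul_pow]
  ring

lemma cycle_inter_TINY_eq_empty {n k : ℕ} {p q δ a : ℝ} {ω : GnpSpace n × GnpSpace n}
    (hp : δ * n * p ≤ a) (hq : δ * n * q ≤ a) (hω : ω ∉ lowDegreeOnCycle n k a)
    {v : Fin n} (c : (gnpGraph ω.1 ⊔ gnpGraph ω.2).Walk v v) (hc : c.IsCycle)
    (hl : c.length ≤ k) :
    {u | u ∈ c.support} ∩ (TINY (gnpGraph ω.1) p δ ∪
      TINY (gnpGraph ω.1 ⊔ gnpGraph ω.2) q δ) = ∅ := by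
  classical
  refine Set.eq_empty_iff_forall_notMem.2 fun u hu => hω ?_
  obtain ⟨hu, ht⟩ := hu
  refine ⟨u, c.rotate u hu, hc.rotate hu, by simpa using hl, ?_⟩
  simp only [TINY, Set.mem_union, Set.mem_ofPred_eq, Nat.card_eq_fintype_card,
    Fintype.card_fin] at ht
  rcases ht with ht | ht
  · linarith
  · have hle : deg (gnpGraph ω.1) u ≤ deg (gnpGraph ω.1 ⊔ gnpGraph ω.2) u :=
      Set.ncard_le_ncard (fun w hw => Or.inl hw) (Set.toFinite _)
    have hle : (deg (gnpGraph ω.1) u : ℝ) ≤ deg (gnpGraph ω.1 ⊔ gnpGraph ω.2) u := by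
      exact_mod_cast hle
    linarith

theorem statement_8 (k : ℕ) (hk : 2 ≤ k) (ε : ℝ) (hε : 0 < ε) :
    ∃ δ : ℝ, 0 < δ ∧ ∀ p₀ p' : ℕ → ℝ,
      (∀ n : ℕ, (1 + ε) * Real.log n / (k * n) ≤ p₀ n) → (∀ n : ℕ, p₀ n ≤ 1) →
      (∀ n : ℕ, 0 ≤ p' n) → (∀ n : ℕ, p' n ≤ ε * p₀ n) → (∀ n : ℕ, p' n ≤ 1) →
      Tendsto (fun n : ℕ =>
        gnp2 n (p₀ n) (p' n) {ω : GnpSpace n × GnpSpace n |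
          ∀ (v : Fin n) (c : (gnpGraph ω.1 ⊔ gnpGraph ω.2).Walk v v),
            c.IsCycle → c.length ≤ 2 * k →
            ({u | u ∈ c.support} ∩
              (TINY (gnpGraph ω.1) (p₀ n) δ ∪
                TINY (gnpGraph ω.1 ⊔ gnpGraph ω.2) (1 - (1 - p₀ n) * (1 - p' n)) δ)).ncard
              ≤ k - 2})
        atTop (nhds 1) := by
  refine ⟨1 / (4 * (1 + ε)), by positivity, fun p₀ p' hlow hp1 hq0 hqε hq1 => ?_⟩
  have hk0 : (0 : ℝ) < k := by exact_mod_cast (by omega : 0 < k)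
  have hp0 : ∀ n, 0 ≤ p₀ n := fun n => le_trans (by positivity) (hlow n)
  set y : ℕ → ℝ := fun n => n * p₀ n / 4 with hy
  have hytop : Tendsto y atTop atTop := by
    have h : Tendsto (fun n : ℕ => (1 + ε) / (4 * k) * Real.log n) atTop atTop :=
      (Real.tendsto_log_atTop.comp tendsto_natCast_atTop_atTop).const_mul_atTop (by positivity)
    refine tendsto_atTop_mono' _ ?_ h
    filter_upwards [eventually_gt_atTop 0] with n hn
    have hn : (0 : ℝ) < n := by exact_mod_cast hn
    calc (1 + ε) / (4 * k) * Real.log n = n * ((1 + ε) * Real.log n / (k * n)) / 4 := by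
          field_simp
      _ ≤ y n := by
          simp only [hy]
          gcongr
          exact hlow n
  set B : ℕ → ℝ := fun n => ∑ l ∈ Finset.range (2 * k),
    (2 ^ (2 * k + 1) * (1 + ε) ^ (2 * k)) * (4 * y n) ^ (l + 1) * Real.exp (-(y n)) with hB
  have hBlim : Tendsto B atTop (nhds 0) := tendsto_sum_pow_mul_exp_neg hytop _ _
  have hlim : Tendsto (fun n => ENNReal.ofReal (1 - B n)) atTop (nhds 1) := by
    have := ENNReal.tendsto_ofReal (hBlim.const_sub 1)
    simpa using this
  have hW : ∀ n, ∀ ω : GnpSpace n × GnpSpace n,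
      0 ≤ bernoulliWeight (p₀ n) ω.1 * bernoulliWeight (p' n) ω.2 := fun n ω =>
    mul_nonneg (bernoulliWeight_nonneg (hp0 n) (hp1 n) _)
      (bernoulliWeight_nonneg (hq0 n) (hq1 n) _)
  refine tendsto_of_tendsto_of_tendsto_of_le_of_le hlim tendsto_const_nhds (fun n => ?_)
    fun n => ?_
  · dsimp only
    rw [gnp2_apply (hp0 n) (hp1 n) (hq0 n) (hq1 n)]
    refine ENNReal.ofReal_le_ofReal ?_
    have hbad := sum_weight_lowDegreeOnCycle_le (n := n) (m := 2 * k) (a := y n)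
      (hp0 n) (hp1 n) (hq0 n) (hq1 n)
    have hbadB : ∑ l ∈ Finset.range (2 * k), 2 ^ (2 * k + 1) *
        (n * (p₀ n + p' n)) ^ (l + 1) * Real.exp (y n - n * p₀ n / 2) ≤ B n := by
      refine Finset.sum_le_sum fun l hl => ?_
      rw [Finset.mem_range] at hl
      have he : y n - n * p₀ n / 2 = -(y n) := by simp only [hy]; ring
      have hs : n * (p₀ n + p' n) ≤ (1 + ε) * (4 * y n) := by
        have : (n : ℝ) * (p₀ n + p' n) ≤ n * (p₀ n + ε * p₀ n) := by
          gcongr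
          exact hqε n
        refine this.trans (le_of_eq ?_)
        simp only [hy]
        ring
      have hyn : 0 ≤ y n := by
        have := hp0 n
        simp only [hy]
        positivity
      rw [he, mul_assoc (2 ^ (2 * k + 1))]
      have hpow : (n * (p₀ n + p' n)) ^ (l + 1) ≤ (1 + ε) ^ (2 * k) * (4 * y n) ^ (l + 1) := by
        have := hp0 n
        have := hq0 n
        calc (n * (p₀ n + p' n)) ^ (l + 1) ≤ ((1 + ε) * (4 * y n)) ^ (l + 1) := by gcongr
          _ = (1 + ε) ^ (l + 1) * (4 * y n) ^ (l + 1) := mul_pow _ _ _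
          _ ≤ _ := by
            gcongr
            · linarith
            · omega
      calc 2 ^ (2 * k + 1) * ((n * (p₀ n + p' n)) ^ (l + 1) * Real.exp (-(y n)))
          ≤ 2 ^ (2 * k + 1) * ((1 + ε) ^ (2 * k) * (4 * y n) ^ (l + 1) * Real.exp (-(y n))) := by
            gcongr
        _ = _ := by ring
    rw [sub_le_iff_le_add]
    refine (sum_bernoulliWeight (n := n) (p₀ n) (p' n)).ge.trans ?_
    refine le_trans ?_ (add_le_add_right (hbad.trans hbadB) _)
    rw [← Finset.sum_add_distrib]
    refine Finset.sum_le_sum fun ω _ => ?_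
    by_cases hω : ω ∈ lowDegreeOnCycle n (2 * k) (y n)
    · rw [Set.indicator_of_mem hω]
      exact le_add_of_nonneg_left (Set.indicator_nonneg (fun ω _ => hW n ω) ω)
    · rw [Set.indicator_of_notMem hω, add_zero, Set.indicator_of_mem]
      intro v c hc hl
      rw [cycle_inter_TINY_eq_empty ?_ ?_ hω c hc hl, Set.ncard_empty]
      · exact Nat.zero_le _
      · have := hp0 n
        calc 1 / (4 * (1 + ε)) * n * p₀ n ≤ 1 / (4 * 1) * n * p₀ n := by
              gcongr
              linarith
          _ = y n := by simp only [hy]; ring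
      · have hp1' : 1 - (1 - p₀ n) * (1 - p' n) ≤ (1 + ε) * p₀ n := by
          nlinarith [mul_nonneg (hp0 n) (hq0 n), hqε n]
        calc 1 / (4 * (1 + ε)) * n * (1 - (1 - p₀ n) * (1 - p' n))
            ≤ 1 / (4 * (1 + ε)) * n * ((1 + ε) * p₀ n) := by gcongr
          _ = y n := by simp only [hy]; field_simp
  · dsimp only
    rw [gnp2_apply (hp0 n) (hp1 n) (hq0 n) (hq1 n), ← ENNReal.ofReal_one]
    refine ENNReal.ofReal_le_ofReal ?_
    rw [← sum_bernoulliWeight (n := n) (p₀ n) (p' n)]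
    exact Finset.sum_le_sum fun ω _ => Set.indicator_le_self' (fun ω _ => hW n ω) ω

end
end RGP
end
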